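/- arXiv:1512.01483 — 4 statements merged into one kernel-verified Lean document; each statement's English description precedes it below -/
import Mathlib

section
/- The modular sweep map sweep_m : A → A is a bijection, where A is the set of words of length N over the alphabet {0,1,...,m-1}. -/
/-- Modular level of the `j`-th letter (0-indexed) of `w`: sum of the first `j+1` letters in `Fin m`. -/
def modLevel (m : ℕ) [NeZero m] (w : List (Fin m)) (j : ℕ) : Fin m :=
  (w.take (j+1)).sum

/-- The modular sweep map: for k = m-1,…,0, read `w` right-to-left and append letters of level k. -/
def msweep (m : ℕ) [NeZero m] (w : List (Fin m)) : List (Fin m) :=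
  ((List.range m).reverse).flatMap (fun k =>
    ((List.range w.length).reverse).filterMap (fun j =>
      if (modLevel m w j : ℕ) = k then some (w.getD j 0) else none))

/-- The modular presweep map: block `k` consists of the letters of level `k`, read right-to-left. -/
def presweep (m : ℕ) [NeZero m] (w : List (Fin m)) (k : Fin m) : List (Fin m) :=
  ((List.range w.length).reverse).filterMap (fun j =>
    if modLevel m w j = k then some (w.getD j 0) else none)

/-- The forgetful map: concatenate the blocks u*_{m-1} | … | u*_0. -/
def forget {m : ℕ} (P : Fin m → List (Fin m)) : List (Fin m) :=
  (List.finRange m).reverse.flatMap P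

/-- One pass of the inverse modular presweep algorithm, returning the removed letters
in removal order (i.e. w_N, w_{N-1}, …), or `none` upon hitting an empty block. -/
def invPresweepAux {m : ℕ} [NeZero m] :
    ℕ → (Fin m → List (Fin m)) → Fin m → Option (List (Fin m))
  | 0, _, _ => some []
  | n+1, P, l =>
    match P l with
    | [] => none
    | a :: rest => (invPresweepAux n (Function.update P l rest) (l - a)).map (fun ws => a :: ws)

/-- The inverse modular presweep map (Algorithm 2): starts at level |u| mod m. -/
def invPresweep {m : ℕ} [NeZero m] (N : ℕ) (P : Fin m → List (Fin m)) :
    Option (List (Fin m)) :=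
  (invPresweepAux N P ((forget P).sum)).map List.reverse

/-- The presweepResidual partitioned word left over when the inverse presweep algorithm stops. -/
def presweepResidual {m : ℕ} [NeZero m] :
    ℕ → (Fin m → List (Fin m)) → Fin m → (Fin m → List (Fin m))
  | 0, P, _ => P
  | n+1, P, l =>
    match P l with
    | [] => P
    | a :: rest => presweepResidual n (Function.update P l rest) (l - a)

/-- Sum of all letters of a partitioned word, as a natural number. -/
def totalSum {m : ℕ} (P : Fin m → List (Fin m)) : ℕ :=
  ∑ k : Fin m, ((P k).map Fin.val).sum

/-- Number of filled cells in column `j` of the balancing array: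
cell (letter a in block k, column j) is filled iff j ∈ {k, k+1, …, k+a-1} mod m. -/
def colCount {m : ℕ} [NeZero m] (P : Fin m → List (Fin m)) (j : Fin m) : ℕ :=
  ∑ k : Fin m, ((P k).filter (fun a => decide (((j - k : Fin m) : ℕ) < (a : ℕ)))).length

/-- The equitable number of filled cells for column `j`. -/
def eqCount {m : ℕ} [NeZero m] (P : Fin m → List (Fin m)) (j : Fin m) : ℕ :=
  if 1 ≤ (j : ℕ) ∧ (j : ℕ) ≤ totalSum P % m then totalSum P / m + 1 else totalSum P / m

/-- A partitioned word is equitable if every column of its balancing array is equitably filled. -/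
def Equitable {m : ℕ} [NeZero m] (P : Fin m → List (Fin m)) : Prop :=
  ∀ j : Fin m, colCount P j = eqCount P j

/-- The list recording, for each position of `forget P`, the index of the block containing it. -/
def blockList {m : ℕ} (P : Fin m → List (Fin m)) : List (Fin m) :=
  (List.finRange m).reverse.flatMap (fun k => (P k).map (fun _ => k))

/-- The index of the block containing the `i`-th letter (0-indexed) of `forget P`. -/
def blockIdx {m : ℕ} [NeZero m] (P : Fin m → List (Fin m)) (i : ℕ) : ℕ :=
  (((blockList P).getD i 0 : Fin m) : ℕ)

/-- A balanced block-suffix of `P`: a suffix of each block, with letter sum ≡ 0 mod m. -/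
def IsBBS {m : ℕ} [NeZero m] (P S : Fin m → List (Fin m)) : Prop :=
  (∀ k, S k <:+ P k) ∧ totalSum S % m = 0

/-- A left balanced block-suffix: a balanced block-suffix with empty rightmost block. -/
def IsLeftBBS {m : ℕ} [NeZero m] (P S : Fin m → List (Fin m)) : Prop :=
  IsBBS P S ∧ S 0 = []

/-- A minimal left balanced block-suffix: nonempty, and its intersection with any balanced
block-suffix is itself or empty. -/
def MinLeftBBS {m : ℕ} [NeZero m] (P S : Fin m → List (Fin m)) : Prop :=
  IsLeftBBS P S ∧ (∃ k, S k ≠ []) ∧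
  ∀ T, IsBBS P T → (∀ k, S k <:+ T k) ∨ (∀ k, S k = [] ∨ T k = [])

/-- Shift the letters of a left balanced block-suffix `S` of `P` one block to the right
(from block k to block k-1). -/
def shiftBy {m : ℕ} [NeZero m] (P S : Fin m → List (Fin m)) : Fin m → List (Fin m) :=
  fun k => S (k + 1) ++ (P k).take ((P k).length - (S k).length)

/-- One step of the rightmost-partition algorithm (Algorithm 4): with `j` the rightmost
(= smallest-index) column less than equitably filled, move the leftmost letter of block `j-1`
to the end of block `j`. -/
def stepR {m : ℕ} [NeZero m] (P Q : Fin m → List (Fin m)) : Prop :=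
  ∃ j : Fin m, colCount P j < eqCount P j ∧
    (∀ j' : Fin m, j' < j → eqCount P j' ≤ colCount P j') ∧
    Q = fun k => if k = j then P j ++ (P (j-1)).take 1
         else if k = j - 1 then (P (j-1)).tail else P k

/-- One step of the leftmost-partition algorithm (Algorithm 5): with `j` the leftmost
(= largest-index) column more than equitably filled, move the rightmost letter of block `j`
to the front of block `j-1`. -/
def stepL {m : ℕ} [NeZero m] (P Q : Fin m → List (Fin m)) : Prop :=
  ∃ j : Fin m, eqCount P j < colCount P j ∧
    (∀ j' : Fin m, j < j' → colCount P j' ≤ eqCount P j') ∧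
    Q = fun k => if k = j then (P j).dropLast
         else if k = j - 1 then (P j).drop ((P j).length - 1) ++ P k else P k

/-- The sum of all letters of a partitioned word in `Fin m`, i.e. |u| mod m. -/
def totalSumFin {m : ℕ} [NeZero m] (P : Fin m → List (Fin m)) : Fin m :=
  ∑ k : Fin m, (P k).sum

/-- Prepend the letter `i` to block `i + |u|_m` of `P`. -/
def addLetter {m : ℕ} [NeZero m] (P : Fin m → List (Fin m)) (i : Fin m) :
    Fin m → List (Fin m) :=
  fun k => if k = i + totalSumFin P then i :: P k else P k

/-- The n-th level of the complete m-ary tree T*_m of partitioned words. -/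
def TreeLevel (m : ℕ) [NeZero m] : ℕ → Set (Fin m → List (Fin m))
  | 0 => {fun _ => []}
  | n+1 => {Q | ∃ P ∈ TreeLevel m n, ∃ i : Fin m, Q = addLetter P i}

/-- The (integer) level of the `j`-th letter (0-indexed) of a word over ℤ. -/
def zlevel (w : List ℤ) (j : ℕ) : ℤ :=
  (w.take (j+1)).sum

/-- The sequence of levels swept: k = -1, -2, …, then …, 2, 1, 0. -/
def sweepKeys (w : List ℤ) : List ℤ :=
  ((List.range ((w.map Int.natAbs).sum)).map (fun t => -((t : ℤ)+1))) ++
  ((List.range ((w.map Int.natAbs).sum + 1)).reverse.map (fun t => (t : ℤ)))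

/-- The sweep map on words over ℤ. -/
def zsweep (w : List ℤ) : List ℤ :=
  (sweepKeys w).flatMap (fun k =>
    ((List.range w.length).reverse).filterMap (fun j =>
      if zlevel w j = k then some (w.getD j 0) else none))

/-- The set A_ℤ of words containing exactly `e j` copies of `a j` for each `j`. -/
def AZ (n : ℕ) (a : Fin n → ℤ) (e : Fin n → ℕ) : Set (List ℤ) :=
  {w | (w : Multiset ℤ) = ∑ j : Fin n, Multiset.replicate (e j) (a j)}

/-- The set A_ℕ of Dyck words: words of A_ℤ with all levels nonnegative. -/
def ANset (n : ℕ) (a : Fin n → ℤ) (e : Fin n → ℕ) : Set (List ℤ) :=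
  {w | w ∈ AZ n a e ∧ ∀ j < w.length, 0 ≤ zlevel w j}

/-- The sequence of levels for the zeta map: k = 0, 1, 2, …, then …, -3, -2, -1. -/
def zetaKeys (w : List ℤ) : List ℤ :=
  ((List.range ((w.map Int.natAbs).sum + 1)).map (fun t => (t : ℤ))) ++
  ((List.range ((w.map Int.natAbs).sum)).reverse.map (fun t => -((t : ℤ)+1)))

/-- The zeta map: sort the letters of `w` by level, reading left-to-right, for
k = 0,1,2,… and then k = …,-3,-2,-1. -/
def zeta (w : List ℤ) : List ℤ :=
  (zetaKeys w).flatMap (fun k =>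
    (List.range w.length).filterMap (fun j =>
      if zlevel w j = k then some (w.getD j 0) else none))

/-- The set of rational Dyck words: -b copies of a, a copies of b, all partial sums ≥ 0. -/
def Dab (a b : ℤ) : Set (List ℤ) :=
  {w | (w : Multiset ℤ) = Multiset.replicate (-b).toNat a + Multiset.replicate a.toNat b ∧
       ∀ j < w.length, 0 ≤ zlevel w j}

/-- The sum of `f k a` over all letters `a` of all blocks `k` of `P`. -/
def blockSum {m : ℕ} (f : Fin m → Fin m → ℤ) (P : Fin m → List (Fin m)) : ℤ :=
  ∑ k, ((P k).map (f k)).sum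

/-- The partitioned word whose only letters are those of `x`, all in block `l`. -/
def singleBlock {m : ℕ} (l : Fin m) (x : List (Fin m)) : Fin m → List (Fin m) :=
  fun k => if k = l then x else []

/-- The concatenation of the blocks of `P`, in decreasing order of the indices. -/
def concatBlocks {m : ℕ} [NeZero m] (P : Fin m → List (Fin m)) : List (Fin m) :=
  (List.range m).reverse.flatMap (fun k => P (Fin.ofNat m k))

/-- The blocks of the word whose reversal is `r` and whose last letter has level `l`. -/
def levelBlocks {m : ℕ} [NeZero m] : List (Fin m) → Fin m → Fin m → List (Fin m)
  | [], _ => fun _ => []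
  | a :: r, l => fun k => singleBlock l [a] k ++ levelBlocks r (l - a) k

/-- Indicator of the event that a letter `a` of level `k` passes through level `j`, that is,
`j` lies in the cyclic interval `(k - a, k]`. -/
def passes {m : ℕ} (j k a : Fin m) : ℤ :=
  if ((k - j : Fin m) : ℕ) < (a : ℕ) then 1 else 0

/-- The contribution of a letter `a` of level `k` to the divergence at `v`. -/
def divergence {m : ℕ} (v k a : Fin m) : ℤ :=
  (if k = v then 1 else 0) - (if k - a = v then 1 else 0)

theorem passes_nonneg {m : ℕ} (j k a : Fin m) : 0 ≤ passes j k a := by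
  unfold passes; split_ifs <;> simp

theorem passes_le_one {m : ℕ} (j k a : Fin m) : passes j k a ≤ 1 := by
  unfold passes; split_ifs <;> simp

section BlockSum

variable {m : ℕ} (f g : Fin m → Fin m → ℤ) (P Q : Fin m → List (Fin m))

theorem blockSum_append :
    blockSum f (fun k => P k ++ Q k) = blockSum f P + blockSum f Q := by
  simp [blockSum, Finset.sum_add_distrib]

theorem blockSum_shift [NeZero m] :
    blockSum f (fun k => P (k + 1)) = blockSum (fun k => f (k - 1)) P := by
  unfold blockSum
  rw [← Equiv.sum_comp (Equiv.addRight (1 : Fin m)) (fun k => ((P k).map (f (k - 1))).sum)]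
  simp

theorem blockSum_singleBlock (l : Fin m) (x : List (Fin m)) :
    blockSum f (singleBlock l x) = (x.map (f l)).sum := by
  unfold blockSum singleBlock
  rw [Finset.sum_eq_single l] <;> simp +contextual

theorem blockSum_empty : blockSum f (fun _ => []) = 0 := by
  simp [blockSum]

theorem blockSum_sub :
    blockSum (fun k a => f k a - g k a) P = blockSum f P - blockSum g P := by
  unfold blockSum
  rw [← Finset.sum_sub_distrib]
  refine Finset.sum_congr rfl fun k _ => ?_
  induction P k with
  | nil => simp
  | cons a t ih => simp only [List.map_cons, List.sum_cons, ih]; ring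

theorem blockSum_sum {ι : Type*} (s : Finset ι) (h : ι → Fin m → Fin m → ℤ) :
    blockSum (fun k a => ∑ i ∈ s, h i k a) P = ∑ i ∈ s, blockSum (h i) P := by
  unfold blockSum
  rw [Finset.sum_comm]
  refine Finset.sum_congr rfl fun k _ => ?_
  induction P k with
  | nil => simp
  | cons a t ih => simp [ih, Finset.sum_add_distrib]

variable {f g P}

theorem blockSum_le_blockSum (h : ∀ k, ∀ a ∈ P k, f k a ≤ g k a) :
    blockSum f P ≤ blockSum g P :=
  Finset.sum_le_sum fun k _ => List.sum_le_sum (h k)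

theorem blockSum_nonneg (h : ∀ k a, 0 ≤ f k a) : 0 ≤ blockSum f P := by
  refine Finset.sum_nonneg fun k _ => List.sum_nonneg fun x hx => ?_
  obtain ⟨a, _, rfl⟩ := List.mem_map.1 hx
  exact h k a

end BlockSum

section ConcatBlocks

variable {m : ℕ} [NeZero m]

/-- Moving the suffix `S k` of each block `k` to the front of block `k - 1` does not change the
concatenation of the blocks, as long as nothing is moved out of block `0`. -/
theorem concatBlocks_shift (R S : Fin m → List (Fin m)) (h0 : S 0 = []) :
    concatBlocks (fun k => S (k + 1) ++ R k) = concatBlocks (fun k => R k ++ S k) := by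
  have key : ∀ n : ℕ,
      (List.range n).reverse.flatMap (fun k => S (Fin.ofNat m k + 1) ++ R (Fin.ofNat m k)) ++ S 0
        = S (Fin.ofNat m n) ++
          (List.range n).reverse.flatMap (fun k => R (Fin.ofNat m k) ++ S (Fin.ofNat m k)) := by
    intro n
    induction n with
    | zero =>
      simp
    | succ n ih =>
      have : Fin.ofNat m (n + 1) = Fin.ofNat m n + 1 := by
        ext; simp [Fin.val_add]
      simp only [List.range_succ, List.reverse_append, List.reverse_singleton,
        List.singleton_append, List.flatMap_cons, List.append_assoc, ih, this]
  have hm := key m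
  have : Fin.ofNat m m = 0 := by ext; simp
  simpa [this, h0, concatBlocks] using hm

theorem concatBlocks_singleBlock_zero (u : List (Fin m)) :
    concatBlocks (singleBlock 0 u) = u := by
  have key : ∀ n, n < m →
      (List.range (n + 1)).reverse.flatMap (fun k => singleBlock 0 u (Fin.ofNat m k)) = u := by
    intro n
    induction n with
    | zero => simp [singleBlock]
    | succ n ih =>
      intro hn
      have hne : ¬ m ∣ n + 1 := fun h => absurd (Nat.le_of_dvd n.succ_pos h) (by omega)
      rw [List.range_succ, List.reverse_append, List.reverse_singleton, List.singleton_append,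
        List.flatMap_cons, ih (by omega)]
      simp [singleBlock, hne]
  have hm := NeZero.pos m
  have := key (m - 1) (by omega)
  rwa [Nat.sub_add_cancel hm] at this

theorem length_concatBlocks (P : Fin m → List (Fin m)) :
    ((concatBlocks P).length : ℤ) = blockSum (fun _ _ => 1) P := by
  have : (concatBlocks P).length = ∑ k, (P k).length := by
    rw [concatBlocks, List.length_flatMap, List.map_reverse, List.sum_reverse,
      ← List.sum_toFinset _ List.nodup_range, List.toFinset_range, Finset.sum_range]
    simp
  simp [this, blockSum]

end ConcatBlocks

section Passes

variable {m : ℕ} [NeZero m]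

theorem val_sub_add_one (k v : Fin m) :
    ((k - (v + 1) : Fin m) : ℕ) =
      if ((k - v : Fin m) : ℕ) = 0 then m - 1 else ((k - v : Fin m) : ℕ) - 1 := by
  rw [← sub_sub]
  generalize k - v = x
  obtain _ | n := m
  · exact x.elim0
  · rw [Fin.coe_sub_one]
    simp only [Fin.ext_iff, Fin.val_zero, Nat.add_sub_cancel]

theorem divergence_eq_passes_sub (v k a : Fin m) :
    divergence v k a = passes v k a - passes (v + 1) k a := by
  have h1 : k = v ↔ ((k - v : Fin m) : ℕ) = 0 := by
    rw [← Fin.val_zero m, ← Fin.ext_iff, sub_eq_zero]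
  have h2 : k - a = v ↔ ((k - v : Fin m) : ℕ) = a := by
    rw [← Fin.ext_iff, sub_eq_iff_eq_add, sub_eq_iff_eq_add, add_comm]
  have := a.isLt
  simp only [divergence, passes, val_sub_add_one, h1, h2]
  split_ifs <;> omega

theorem passes_le_passes_add_one {v k : Fin m} (h : k ≠ v) (a : Fin m) :
    passes v k a ≤ passes (v + 1) k a := by
  have h1 : ((k - v : Fin m) : ℕ) ≠ 0 := by
    rw [← Fin.val_zero m, Ne, ← Fin.ext_iff, sub_eq_zero]
    exact h
  simp only [passes, val_sub_add_one, h1, if_false]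
  split_ifs <;> omega

theorem passes_sub_one (i j a : Fin m) : passes i (j - 1) a = passes (i + 1) j a := by
  rw [passes, passes, ← sub_sub, sub_right_comm]

theorem passes_le_passes_zero {j k : Fin m} (h : k < j) (a : Fin m) :
    passes j k a ≤ passes 0 k a := by
  have h1 : ((k - j : Fin m) : ℕ) = m - j + k := by
    rw [Fin.sub_def]
    exact Nat.mod_eq_of_lt (by omega)
  simp only [passes, h1, sub_zero]
  split_ifs <;> omega

theorem sum_passes (k a : Fin m) : ∑ j, passes j k a = (a : ℕ) := by
  have h := Equiv.sum_comp (Equiv.subLeft k)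
    (fun x : Fin m => if (x : ℕ) < (a : ℕ) then (1 : ℤ) else 0)
  simp only [Equiv.subLeft_apply] at h
  simp only [passes, h, Finset.sum_boole]
  have : (Finset.univ.filter fun x : Fin m => (x : ℕ) < a) = Finset.Iio a := by
    ext x; simp
  rw [this, Fin.card_Iio]

end Passes

section LevelBlocks

variable {m : ℕ} [NeZero m]

theorem blockSum_divergence_levelBlocks (v : Fin m) (r : List (Fin m)) (l : Fin m) :
    blockSum (divergence v) (levelBlocks r l) =
      (if l = v then 1 else 0) - (if l - r.sum = v then 1 else 0) := by
  induction r generalizing l with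
  | nil => simp [levelBlocks, blockSum_empty]
  | cons a r ih =>
    have hsum : l - a - r.sum = l - (a :: r).sum := by rw [List.sum_cons, sub_sub]
    simp only [levelBlocks, blockSum_append, blockSum_singleBlock, ih, hsum,
      List.map_singleton, List.sum_singleton, divergence]
    ring

theorem blockSum_one_levelBlocks (r : List (Fin m)) (l : Fin m) :
    blockSum (fun _ _ => 1) (levelBlocks r l) = r.length := by
  induction r generalizing l with
  | nil => simp [levelBlocks, blockSum_empty]
  | cons a r ih => simp [levelBlocks, blockSum_append, blockSum_singleBlock, ih, add_comm]

/-- The inverse presweep walk from level `l` runs until it reaches an empty block. -/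
theorem exists_levelBlocks_append (P : Fin m → List (Fin m)) (l : Fin m) :
    ∃ (r : List (Fin m)) (S : Fin m → List (Fin m)), S (l - r.sum) = [] ∧
      P = fun k => levelBlocks r l k ++ S k := by
  induction h : ∑ k, (P k).length generalizing P l with
  | zero =>
    refine ⟨[], P, ?_, by simp [levelBlocks]⟩
    simpa using Finset.sum_eq_zero_iff.1 h (l - List.sum []) (Finset.mem_univ _)
  | succ n ih =>
    rcases hl : P l with _ | ⟨a, t⟩
    · exact ⟨[], P, by simpa using hl, by simp [levelBlocks]⟩
    · have hP : P = fun k => singleBlock l [a] k ++ Function.update P l t k := by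
        funext k
        by_cases hk : k = l
        · subst hk; simp [singleBlock, hl]
        · simp [singleBlock, hk]
      obtain ⟨r, S, hS, hrS⟩ := ih (Function.update P l t) (l - a) (by
        rw [hP] at h
        simp only [List.length_append, Finset.sum_add_distrib] at h
        have : ∑ k, (singleBlock l [a] k).length = 1 := by
          simp [singleBlock, apply_ite List.length]
        omega)
      refine ⟨a :: r, S, by rwa [List.sum_cons, ← sub_sub], ?_⟩
      rw [hP, hrS]
      simp [levelBlocks]

theorem presweep_append_singleton (w : List (Fin m)) (a k : Fin m) :
    presweep m (w ++ [a]) k = singleBlock (w ++ [a]).sum [a] k ++ presweep m w k := by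
  unfold presweep
  simp only [List.length_append, List.length_singleton, List.range_succ, List.reverse_append,
    List.reverse_singleton, List.singleton_append, List.filterMap_cons]
  have htail : (List.range w.length).reverse.filterMap
        (fun j => if modLevel m (w ++ [a]) j = k then some ((w ++ [a]).getD j 0) else none) =
      (List.range w.length).reverse.filterMap
        (fun j => if modLevel m w j = k then some (w.getD j 0) else none) := by
    refine List.filterMap_congr fun j hj => ?_
    have hj : j < w.length := by simpa using hj
    rw [modLevel, modLevel, List.take_append_of_le_length (by omega),
      List.getD_append _ _ _ _ hj]
  have hlast : modLevel m (w ++ [a]) w.length = (w ++ [a]).sum := by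
    rw [modLevel, List.take_of_length_le (by simp)]
  rw [htail, hlast]
  by_cases hk : (w ++ [a]).sum = k
  · simp [singleBlock, hk]
  · simp only [singleBlock, if_neg hk, if_neg (Ne.symm hk), List.nil_append]

theorem presweep_eq_levelBlocks (w : List (Fin m)) :
    presweep m w = levelBlocks w.reverse w.sum := by
  induction w using List.reverseRecOn with
  | nil => rfl
  | append_singleton w a ih =>
    funext k
    rw [presweep_append_singleton, ih]
    simp [levelBlocks]

theorem msweep_eq_concatBlocks (w : List (Fin m)) :
    msweep m w = concatBlocks (levelBlocks w.reverse w.sum) := by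
  rw [← presweep_eq_levelBlocks, msweep, concatBlocks]
  refine List.flatMap_congr fun k hk => ?_
  have hk : k < m := by simpa using hk
  simp [presweep, Fin.ext_iff, Nat.mod_eq_of_lt hk]

theorem length_msweep (w : List (Fin m)) : (msweep m w).length = w.length := by
  have h := length_concatBlocks (levelBlocks w.reverse w.sum)
  rw [← msweep_eq_concatBlocks, blockSum_one_levelBlocks, List.length_reverse] at h
  exact_mod_cast h

end LevelBlocks

section Quota

variable {m : ℕ} [NeZero m]

/-- The number of letters passing through level `j` when `q * m + r` unit steps are spread evenly
along the cyclic path of that length starting at level `0`. -/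
def quota (q r : ℕ) (j : Fin m) : ℤ :=
  q + if j ≠ 0 ∧ (j : ℕ) ≤ r then 1 else 0

theorem quota_zero (q r : ℕ) : quota q r (0 : Fin m) = q := by
  simp [quota]

theorem le_quota (q r : ℕ) (j : Fin m) : (q : ℤ) ≤ quota q r j := by
  unfold quota; split_ifs <;> simp

theorem quota_le (q r : ℕ) (j : Fin m) : quota q r j ≤ q + 1 := by
  unfold quota; split_ifs <;> simp

theorem val_add_one_eq_ite (j : Fin m) :
    ((j + 1 : Fin m) : ℕ) = if (j : ℕ) + 1 = m then 0 else (j : ℕ) + 1 := by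
  obtain _ | n := m
  · exact j.elim0
  · rw [Fin.val_add_one]
    simp only [Fin.ext_iff, Fin.val_last, Nat.add_right_cancel_iff]

theorem quota_sub_quota_add_one (q : ℕ) {r : ℕ} (hr : r < m) (j : Fin m) :
    quota q r j - quota q r (j + 1) =
      (if Fin.ofNat m r = j then 1 else 0) - (if 0 = j then 1 else 0) := by
  have := j.isLt
  simp only [quota, Fin.ext_iff, Ne, val_add_one_eq_ite, Fin.val_ofNat, Nat.mod_eq_of_lt hr,
    Fin.val_zero]
  by_cases hj : (j : ℕ) + 1 = m <;>
    simp only [hj, if_true, if_false, not_true_eq_false, not_false_eq_true, true_and, false_and,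
      Nat.add_eq_zero_iff, one_ne_zero, and_false] <;>
    split_ifs <;> omega

theorem quota_add_one_le (q r : ℕ) {j : Fin m} (hj : j ≠ 0) :
    quota q r (j + 1) ≤ quota q r j := by
  simp only [quota, Fin.ext_iff, Ne, val_add_one_eq_ite, Fin.val_zero] at hj ⊢
  split_ifs <;> omega

theorem sum_quota (q : ℕ) {r : ℕ} (hr : r < m) : ∑ j : Fin m, quota q r j = m * q + r := by
  have h : (Finset.univ.filter fun j : Fin m => j ≠ 0 ∧ (j : ℕ) ≤ r) =
      Finset.Ioc 0 (Fin.ofNat m r) := by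
    ext j
    simp [Fin.le_def, Nat.mod_eq_of_lt hr, Fin.pos_iff_ne_zero]
  simp only [quota, Finset.sum_add_distrib, Finset.sum_boole, h]
  simp [Nat.mod_eq_of_lt hr]

end Quota

section Surjectivity

variable {m : ℕ} [NeZero m]

theorem exists_minimal_of_nonneg {α : Type*} {p : α → Prop} (hp : ∃ x, p x) (φ : α → ℤ)
    (hφ : ∀ x, 0 ≤ φ x) : ∃ x, p x ∧ ∀ y, p y → φ x ≤ φ y := by
  obtain ⟨x, hx, hmin⟩ := (measure fun x => (φ x).toNat).wf.has_min {x | p x} hp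
  refine ⟨x, hx, fun y hy => ?_⟩
  have h := hmin y hy
  have := hφ x
  have := hφ y
  change ¬ (φ y).toNat < (φ x).toNat at h
  omega

/-- No level `j ≠ 0` exceeds its quota unless all letters lie in blocks below `j`. -/
def WithinQuota (q r : ℕ) (P : Fin m → List (Fin m)) : Prop :=
  ∀ j, j ≠ 0 → (∀ k, j ≤ k → P k = []) ∨ blockSum (passes j) P ≤ quota q r j

/-- Moving the first letter of block `v` to the end of block `v + 1`. -/
theorem WithinQuota.move {q r : ℕ} {P : Fin m → List (Fin m)} (h : WithinQuota q r P)
    {v a : Fin m} {t : List (Fin m)} (hv : v < v + 1) (hP : P v = a :: t)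
    (hlt : blockSum (passes (v + 1)) P < quota q r (v + 1)) :
    ∃ Q : Fin m → List (Fin m), WithinQuota q r Q ∧ concatBlocks Q = concatBlocks P ∧
      ∀ f, blockSum f Q = blockSum f P + f (v + 1) a - f v a := by
  set R := Function.update P v t with hR
  set S := singleBlock (v + 1) [a] with hS
  have hPRS : P = fun k => S (k + 1) ++ R k := by
    funext k
    by_cases hk : k = v
    · subst hk; simp [hS, hR, singleBlock, hP]
    · simp [hS, hR, singleBlock, hk]
  have hsum : ∀ f, blockSum f (fun k => R k ++ S k) = blockSum f P + f (v + 1) a - f v a := by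
    intro f
    have h1 := blockSum_append f (fun k => S (k + 1)) R
    rw [← hPRS, blockSum_shift, hS, blockSum_singleBlock] at h1
    rw [blockSum_append, h1, hS, blockSum_singleBlock]
    simp only [List.map_singleton, List.sum_singleton, add_sub_cancel_right]
    ring
  have hne : v + 1 ≠ 0 := fun h0 => absurd (h0 ▸ hv) (by simp)
  refine ⟨fun k => R k ++ S k, fun j hj => ?_, ?_, hsum⟩
  · rw [hsum]
    by_cases hjv : j = v + 1
    · subst hjv
      have := passes_le_one (v + 1) (v + 1) a
      have := passes_nonneg (v + 1) v a
      right; omega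
    · have hle : passes j (v + 1) a ≤ passes j v a := by
        have := passes_le_passes_add_one (Ne.symm hjv) a
        rwa [← passes_sub_one, add_sub_cancel_right] at this
      rcases h j hj with h0 | h0
      · have hvj : v + 1 < j := by
          have : v < j := by
            by_contra hvj
            simp [h0 v (not_lt.1 hvj)] at hP
          have h1 := val_add_one_eq_ite v
          simp only [Fin.lt_def, Fin.ext_iff] at *
          split_ifs at h1 <;> omega
        left
        intro k hk
        have hkv : k ≠ v := (hv.trans (hvj.trans_le hk)).ne'
        have hkv' : k ≠ v + 1 := (hvj.trans_le hk).ne'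
        simp [hR, hS, singleBlock, hkv, hkv', h0 k hk]
      · right; omega
  · conv_rhs => rw [hPRS]
    exact (concatBlocks_shift R S (by simp [hS, singleBlock, hne.symm])).symm

theorem WithinQuota.eq_quota {q r : ℕ} {P : Fin m → List (Fin m)} (h : WithinQuota q r P)
    (htot : ∑ j, blockSum (passes j) P = ∑ j : Fin m, quota q r j)
    (hstuck : ∀ v : Fin m, v < v + 1 → blockSum (passes (v + 1)) P < quota q r (v + 1) →
      P v = [])
    (j : Fin m) : blockSum (passes j) P = quota q r j := by
  set c := fun j : Fin m => blockSum (passes j) P with hc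
  have hexcess : ∀ j : Fin m, j ≠ 0 → quota q r j < c j → c j ≤ c 0 := by
    intro j hj hlt
    rcases h j hj with h0 | h0
    · refine blockSum_le_blockSum fun k a ha => passes_le_passes_zero ?_ a
      by_contra hk
      simp [h0 k (not_lt.1 hk)] at ha
    · exact absurd h0 (not_le.2 hlt)
  have hzero : quota q r (0 : Fin m) ≤ c 0 := by
    by_contra! hlt
    obtain ⟨j, -, hj⟩ : ∃ j ∈ Finset.univ, quota q r j < c j := by
      by_contra! hle
      exact (Finset.sum_lt_sum hle ⟨0, Finset.mem_univ _, hlt⟩).ne htot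
    have hj0 : j ≠ 0 := by rintro rfl; exact absurd hj hlt.not_gt
    have := hexcess j hj0 hj
    have := le_quota q r j
    rw [quota_zero] at hlt
    omega
  have hge : ∀ n (hn : n < m), quota q r ⟨n, hn⟩ ≤ c ⟨n, hn⟩ := by
    intro n
    induction n with
    | zero => exact fun _ => hzero
    | succ n ih =>
      intro hn
      obtain ⟨v, hv⟩ : ∃ v : Fin m, v = ⟨n, by omega⟩ := ⟨_, rfl⟩
      have hv1 : (⟨n + 1, hn⟩ : Fin m) = v + 1 := by
        rw [Fin.ext_iff, val_add_one_eq_ite, hv]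
        simp [hn.ne]
      have ihv : quota q r v ≤ c v := hv ▸ ih (by omega)
      rw [hv1]
      by_contra! hlt
      have hvlt : v < v + 1 := by rw [← hv1, hv]; simp
      have hnil := hstuck v hvlt hlt
      have hle : c v ≤ c (v + 1) := by
        refine blockSum_le_blockSum fun k a ha => passes_le_passes_add_one ?_ a
        rintro rfl
        simp [hnil] at ha
      have hv0 : v = 0 := by
        by_contra hv0
        have := quota_add_one_le q r hv0
        omega
      rw [hv0] at hle hlt ihv
      have h1 := quota_le q r (0 + 1 : Fin m)
      rw [quota_zero] at ihv
      have hall : ∀ j ∈ Finset.univ, c j ≤ quota q r j := by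
        intro j _
        by_contra! hj
        have h2 := le_quota q r j
        by_cases hj0 : j = 0
        · subst hj0; omega
        · have := hexcess j hj0 hj; omega
      exact (Finset.sum_lt_sum hall ⟨0 + 1, Finset.mem_univ _, hlt⟩).ne htot
  exact ((Finset.sum_eq_sum_iff_of_le fun (j : Fin m) _ => hge j j.isLt).1 htot.symm j
    (Finset.mem_univ _)).symm

theorem exists_blocks_divergence_eq (u : List (Fin m)) :
    ∃ (P : Fin m → List (Fin m)) (L : Fin m), concatBlocks P = u ∧
      ∀ v, blockSum (divergence v) P = (if L = v then 1 else 0) - (if 0 = v then 1 else 0) := by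
  set t : ℕ := (u.map Fin.val).sum with ht
  have hr : t % m < m := Nat.mod_lt _ (NeZero.pos m)
  obtain ⟨P, ⟨hP, hu, htot⟩, hmin⟩ := exists_minimal_of_nonneg
    (p := fun P : Fin m → List (Fin m) => WithinQuota (t / m) (t % m) P ∧ concatBlocks P = u ∧
      ∑ j, blockSum (passes j) P = ∑ j : Fin m, quota (t / m) (t % m) j)
    ⟨singleBlock 0 u, fun j hj => Or.inl fun k hk => by
        have : k ≠ 0 := (lt_of_lt_of_le (Fin.pos_iff_ne_zero.2 hj) hk).ne'
        simp [singleBlock, this],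
      concatBlocks_singleBlock_zero u, by
        rw [← blockSum_sum, blockSum_singleBlock, sum_quota _ hr]
        simp only [sum_passes]
        have := Nat.div_add_mod t m
        rw [ht] at this ⊢
        have hcast : (u.map fun a : Fin m => ((a : ℕ) : ℤ)).sum =
            ((u.map Fin.val).sum : ℕ) := by
          rw [Nat.cast_list_sum, List.map_map]; rfl
        rw [hcast]
        exact_mod_cast this.symm⟩
    (blockSum fun k _ => (m : ℤ) - (k : ℕ)) fun P => blockSum_nonneg fun k _ => by omega
  have hq : ∀ j, blockSum (passes j) P = quota (t / m) (t % m) j := by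
    refine hP.eq_quota htot fun v hv hlt => ?_
    rcases hPv : P v with _ | ⟨a, s⟩
    · rfl
    · obtain ⟨Q, hQ, hQu, hQs⟩ := hP.move hv hPv hlt
      have hle := hmin Q ⟨hQ, hQu.trans hu, by
        rw [← htot, ← blockSum_sum, ← blockSum_sum, hQs]
        simp [sum_passes]⟩
      rw [hQs] at hle
      rw [Fin.lt_def] at hv
      omega
  refine ⟨P, Fin.ofNat m (t % m), hu, fun v => ?_⟩
  have : divergence v = fun k a => passes v k a - passes (v + 1) k a := by
    funext k a; exact divergence_eq_passes_sub v k a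
  rw [this, blockSum_sub, hq, hq, quota_sub_quota_add_one _ hr]

theorem exists_levelBlocks_eq (u : List (Fin m)) :
    ∃ r : List (Fin m), concatBlocks (levelBlocks r r.sum) = u := by
  obtain ⟨P₀, L, hP₀⟩ := exists_blocks_divergence_eq u
  obtain ⟨P, ⟨hu, hdiv⟩, hmin⟩ := exists_minimal_of_nonneg
    (p := fun P : Fin m → List (Fin m) => concatBlocks P = u ∧ ∀ v, blockSum (divergence v) P =
      (if L = v then 1 else 0) - (if 0 = v then 1 else 0)) ⟨P₀, hP₀⟩
    (blockSum fun k _ => ((k : ℕ) : ℤ)) fun P => blockSum_nonneg fun k _ => by omega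
  obtain ⟨r, S, hS, hPS⟩ := exists_levelBlocks_append P L
  have hdivS : ∀ v, blockSum (divergence v) S =
      (if L - r.sum = v then 1 else 0) - (if 0 = v then 1 else 0) := by
    intro v
    have h := hdiv v
    rw [hPS, blockSum_append, blockSum_divergence_levelBlocks] at h
    omega
  have hL : L - r.sum = 0 := by
    by_contra hne
    have h := hdivS (L - r.sum)
    have hle : blockSum (divergence (L - r.sum)) S ≤ blockSum (fun _ _ => 0) S := by
      refine blockSum_le_blockSum fun k a ha => ?_
      have hk : k ≠ L - r.sum := by rintro rfl; simp [hS] at ha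
      simp only [divergence, hk, if_false]
      split_ifs <;> simp
    rw [h, if_pos rfl, if_neg (Ne.symm hne)] at hle
    simp [blockSum] at hle
  rw [hL] at hS hdivS
  have hle := hmin (fun k => S (k + 1) ++ levelBlocks r L k) ⟨by
    rw [concatBlocks_shift _ _ hS, ← hPS, hu], fun v => by
    have hshift : (fun k => divergence v (k - 1)) = divergence (v + 1) := by
      funext k a
      simp only [divergence, sub_eq_iff_eq_add, add_right_comm]
    rw [← hdiv v, blockSum_append, blockSum_shift, hshift, hdivS, sub_self, hPS, blockSum_append,
      hdivS, sub_self, add_comm]⟩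
  have hdrop : blockSum (fun k _ => (((k - 1 : Fin m) : ℕ) : ℤ)) S ≤
      blockSum (fun k _ => ((k : ℕ) : ℤ) - 1) S := by
    refine blockSum_le_blockSum fun k a ha => ?_
    have hk : (k : ℕ) ≠ 0 := by
      intro hk
      rw [show k = 0 from Fin.ext hk, hS] at ha
      simp at ha
    have h := val_sub_add_one k 0
    rw [zero_add, sub_zero, if_neg hk] at h
    omega
  rw [blockSum_append, blockSum_shift, hPS, blockSum_append] at hle
  rw [blockSum_sub] at hdrop
  have hempty : S = fun _ => [] := by
    have h1 : blockSum (fun _ _ => 1) S = ∑ k, ((S k).length : ℤ) := by simp [blockSum]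
    have h2 : ∑ k, ((S k).length : ℤ) = 0 :=
      le_antisymm (by omega) (Finset.sum_nonneg fun _ _ => by omega)
    funext k
    have := (Finset.sum_eq_zero_iff_of_nonneg fun _ _ => by omega).1 h2 k (Finset.mem_univ k)
    exact List.length_eq_zero_iff.1 (by exact_mod_cast this)
  refine ⟨r, ?_⟩
  rw [← hu, hPS, hempty, ← sub_eq_zero.1 hL]
  simp

theorem msweep_surjective : Function.Surjective (msweep m) := by
  intro u
  obtain ⟨r, hr⟩ := exists_levelBlocks_eq u
  refine ⟨r.reverse, ?_⟩
  rw [msweep_eq_concatBlocks, List.reverse_reverse, List.sum_reverse, hr]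

end Surjectivity

/-- The modular sweep map is a bijection on the set of words of length N
over the alphabet {0, 1, …, m-1}. -/
theorem modular_sweep_bijective (m N : ℕ) [NeZero m] :
    Set.BijOn (msweep m)
      {w : List (Fin m) | w.length = N} {w : List (Fin m) | w.length = N} := by
  have hmaps : Set.MapsTo (msweep m) {w : List (Fin m) | w.length = N} {w | w.length = N} :=
    fun w hw => (length_msweep w).trans hw
  refine ((List.finite_length_eq (Fin m) N).surjOn_iff_bijOn_of_mapsTo hmaps).1 fun u hu => ?_
  obtain ⟨w, rfl⟩ := msweep_surjective u
  exact ⟨w, (length_msweep w).symm.trans hu, rfl⟩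
end

section
/- Every word u ∈ A admits at least one successful partition. -/
section Edges

variable {m : ℕ}

/-- The multiset of pairs (block, letter) of a partitioned word, viewed as the edges
`block → block - letter` travelled by the inverse modular presweep algorithm. -/
def edges (P : Fin m → List (Fin m)) : Multiset (Fin m × Fin m) :=
  ∑ k, ((P k : Multiset (Fin m)).map (Prod.mk k))

/-- The edges of `P` satisfy the degree conditions of an Eulerian trail from `l` to `0`. -/
def DegreeBalanced [NeZero m] (P : Fin m → List (Fin m)) (l : Fin m) : Prop :=
  (edges P).map Prod.fst + {0} = (edges P).map (fun e => e.1 - e.2) + {l}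

theorem mem_edges {P : Fin m → List (Fin m)} {k a : Fin m} : (k, a) ∈ edges P ↔ a ∈ P k := by
  simp [edges, Multiset.mem_sum]

theorem edges_append (P Q : Fin m → List (Fin m)) :
    edges (fun k => P k ++ Q k) = edges P + edges Q := by
  simp [edges, ← Multiset.coe_add, Finset.sum_add_distrib, -Multiset.map_coe]

theorem edges_eq_cons {P : Fin m → List (Fin m)} {l a : Fin m} {rest : List (Fin m)}
    (h : P l = a :: rest) : edges P = (l, a) ::ₘ edges (Function.update P l rest) := by
  classical
  unfold edges
  rw [← Finset.add_sum_erase _ _ (Finset.mem_univ l),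
    ← Finset.add_sum_erase _ _ (Finset.mem_univ l), h, Function.update_self, ← Multiset.cons_coe, Multiset.map_cons, Multiset.cons_add]
  congr 2
  refine Finset.sum_congr rfl fun k hk => ?_
  rw [Function.update_of_ne (Finset.ne_of_mem_erase hk)]

theorem edges_shift [NeZero m] (S : Fin m → List (Fin m)) :
    edges (fun k => S (k + 1)) = (edges S).map (fun e => (e.1 - 1, e.2)) := by
  unfold edges
  rw [← Multiset.coe_mapAddMonoidHom, map_sum]
  refine Fintype.sum_equiv (Equiv.addRight 1) _ _ fun k => ?_
  simp [Function.comp_def]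

theorem isSome_or_exists_balanced_suffix [NeZero m] (n : ℕ) (P : Fin m → List (Fin m)) (l : Fin m)
    (hP : DegreeBalanced P l) (hn : (edges P).card = n) :
    (invPresweepAux n P l).isSome ∨ ∃ S : Fin m → List (Fin m), (∀ k, S k <:+ P k) ∧ S 0 = [] ∧
      edges S ≠ 0 ∧ (edges S).map Prod.fst = (edges S).map (fun e => e.1 - e.2) := by
  induction n generalizing P l with
  | zero => left; simp [invPresweepAux]
  | succ n ih =>
    cases h : P l with
    | nil =>
      right
      have hl : l ∈ (edges P).map Prod.fst + {0} := by rw [hP]; simp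
      have hl0 : l = 0 := by
        rcases Multiset.mem_add.1 hl with hl | hl
        · obtain ⟨⟨k, a⟩, he, rfl⟩ := Multiset.mem_map.1 hl
          rw [mem_edges] at he
          simp [h] at he
        · simpa using hl
      subst hl0
      refine ⟨P, fun k => List.suffix_refl _, h, ?_, add_right_cancel hP⟩
      intro h0
      simp [h0] at hn
    | cons a rest =>
      have he := edges_eq_cons h
      have hP' : DegreeBalanced (Function.update P l rest) (l - a) := by
        unfold DegreeBalanced at hP ⊢
        rw [he, Multiset.map_cons, Multiset.map_cons] at hP
        simp only [Multiset.cons_add] at hP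
        rw [Multiset.add_comm _ {l}, Multiset.singleton_add, Multiset.cons_swap,
          Multiset.cons_inj_right] at hP
        rw [hP, Multiset.add_comm _ {l - a}, Multiset.singleton_add]
      have hn' : (edges (Function.update P l rest)).card = n := by
        rw [he] at hn
        simpa using hn
      rcases ih _ _ hP' hn' with hs | ⟨S, hS, h0, h1, h2⟩
      · left
        simpa [invPresweepAux, h] using hs
      · refine Or.inr ⟨S, fun k => (hS k).trans ?_, h0, h1, h2⟩
        by_cases hk : k = l
        · subst hk
          rw [h, Function.update_self]
          exact List.suffix_cons _ _
        · rw [Function.update_of_ne hk]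

theorem forget_eq_flatMap_range [NeZero m] (P : Fin m → List (Fin m)) :
    forget P = (List.range m).reverse.flatMap (fun t => P (Fin.ofNat m t)) := by
  have h : List.range m = (List.finRange m).map Fin.val := by simp
  rw [forget, h, ← List.map_reverse, List.flatMap_map]
  simp

theorem flatMap_shift {α : Type*} (S Q : ℕ → List α) (n : ℕ) :
    (List.range n).reverse.flatMap (fun t => S (t + 1) ++ Q t) ++ S 0 =
      S n ++ (List.range n).reverse.flatMap (fun t => Q t ++ S t) := by
  induction n with
  | zero => simp
  | succ n ih => simp [List.range_succ, ih]

theorem forget_shift [NeZero m] {S Q : Fin m → List (Fin m)} (h0 : S 0 = []) :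
    forget (fun k => S (k + 1) ++ Q k) = forget (fun k => Q k ++ S k) := by
  have h := flatMap_shift (fun t => S (Fin.ofNat m t)) (fun t => Q (Fin.ofNat m t)) m
  have h1 : Fin.ofNat m m = 0 := by ext; simp
  have h2 : Fin.ofNat m 0 = 0 := by ext; simp
  have h3 (t : ℕ) : Fin.ofNat m (t + 1) = Fin.ofNat m t + 1 := by
    ext
    simp [Fin.val_add]
  simp only [h0, h1, h2, h3, List.append_nil, List.nil_append] at h
  rw [forget_eq_flatMap_range, forget_eq_flatMap_range, h]

theorem card_edges (P : Fin m → List (Fin m)) : (edges P).card = (forget P).length := by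
  rw [edges, forget, List.length_flatMap, List.map_reverse, List.sum_reverse, ← Fin.sum_univ_def]
  simp

theorem val_sub_one_add_one [NeZero m] {k : Fin m} (hk : k ≠ 0) : (k - 1).val + 1 = k.val := by
  have h : k.val ≠ 0 := fun h => hk (Fin.ext (by simpa using h))
  rw [Fin.val_sub_one_of_ne_zero hk]
  omega

theorem sum_val_shift [NeZero m] (s : Multiset (Fin m × Fin m)) (hs : ∀ e ∈ s, e.1 ≠ 0) :
    ((s.map (fun e => (e.1 - 1, e.2))).map (fun e => e.1.val)).sum + s.card =
      (s.map (fun e => e.1.val)).sum := by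
  induction s using Multiset.induction_on with
  | empty => simp
  | cons e s ih =>
    have h1 := val_sub_one_add_one (hs e (Multiset.mem_cons_self _ _))
    have h2 := ih fun e he => hs e (Multiset.mem_cons_of_mem he)
    simp only [Multiset.map_cons, Multiset.sum_cons, Multiset.card_cons]
    omega

theorem exists_isSome_of_balanced [NeZero m] (P : Fin m → List (Fin m))
    (hP : DegreeBalanced P (forget P).sum) :
    ∃ P' : Fin m → List (Fin m), forget P' = forget P ∧
      (invPresweep (forget P).length P').isSome := by
  induction h : ((edges P).map (fun e => e.1.val)).sum using Nat.strong_induction_on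
    generalizing P with
  | _ M ih =>
    rcases isSome_or_exists_balanced_suffix _ P _ hP (card_edges P) with hs | ⟨S, hS, h0, h1, h2⟩
    · exact ⟨P, rfl, by simpa [invPresweep] using hs⟩
    · choose Q hQ using hS
      have hPQ : P = fun k => Q k ++ S k := funext fun k => (hQ k).symm
      have hf := forget_shift (S := S) (Q := Q) h0
      rw [← hPQ] at hf
      have he : edges (fun k => S (k + 1) ++ Q k) =
          (edges S).map (fun e => (e.1 - 1, e.2)) + edges Q := by
        rw [edges_append, edges_shift]
      have hPe : edges P = edges Q + edges S := by rw [hPQ, edges_append]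
      have hS0 : ∀ e ∈ edges S, e.1 ≠ 0 := by
        rintro ⟨k, a⟩ hka rfl
        rw [mem_edges] at hka
        simp [h0] at hka
      have hsum := sum_val_shift (edges S) hS0
      have hpos := Multiset.card_pos.2 h1
      rw [← hf]
      refine ih _ ?_ _ ?_ rfl
      · rw [← h, he, hPe]
        simp only [Multiset.map_add, Multiset.sum_add]
        omega
      · have h3 : (edges S).map (fun e => e.1 - 1) = (edges S).map (fun e => e.1 - 1 - e.2) := by
          have := congrArg (Multiset.map (fun k => k - 1)) h2
          simpa [Multiset.map_map, sub_right_comm] using this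
        rw [hf]
        unfold DegreeBalanced at hP ⊢
        rw [he]
        rw [hPe, Multiset.map_add, Multiset.map_add, h2,
          Multiset.add_comm _ (Multiset.map _ (edges S)),
          Multiset.add_comm _ (Multiset.map _ (edges S)), add_assoc, add_assoc] at hP
        have hP := add_left_cancel hP
        simp only [Multiset.map_add, Multiset.map_map, Function.comp_def, h3, add_assoc, hP]

end Edges

section Scheduling

/-- List scheduling of one job: given the sorted list of times at which the machines become free,
run a job of length `a` on the machine that is free first. -/
def assign : List ℕ → ℕ → List ℕ
  | [], _ => []
  | t :: s, a => s.orderedInsert (· ≤ ·) (t + a)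

/-- The starting times of the jobs `u` under list scheduling from the free times `s`. -/
def starts : List ℕ → List ℕ → List ℕ
  | _, [] => []
  | s, a :: u => s.headD 0 :: starts (assign s a) u

theorem orderedInsert_mono {s s' : List ℕ} (h : List.Forall₂ (· ≤ ·) s s')
    (hs : s.Pairwise (· ≤ ·)) (hs' : s'.Pairwise (· ≤ ·)) {a b : ℕ} (hab : a ≤ b) :
    List.Forall₂ (· ≤ ·) (s.orderedInsert (· ≤ ·) a) (s'.orderedInsert (· ≤ ·) b) := by
  induction h generalizing a b with
  | nil => simpa using hab
  | @cons x y t t' hxy ht ih =>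
    have insert_eq {z : ℕ} {v : List ℕ} (h : (z :: v).Pairwise (· ≤ ·)) :
        v.orderedInsert (· ≤ ·) z = z :: v := by
      cases v with
      | nil => rfl
      | cons w v => exact List.orderedInsert_cons_of_le _ _ (List.rel_of_pairwise_cons h (by simp))
    have ih' {c d : ℕ} (hcd : c ≤ d) := ih hs.of_cons hs'.of_cons hcd
    rw [List.orderedInsert_cons, List.orderedInsert_cons]
    split_ifs with h1 h2 h2
    · exact .cons hab (.cons hxy ht)
    · refine .cons (by omega) ?_
      rw [← insert_eq hs]
      exact ih' (by omega)
    · refine .cons (by omega) ?_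
      rw [← insert_eq hs']
      exact ih' (by omega)
    · exact .cons hxy (ih' hab)

theorem length_assign (s : List ℕ) (a : ℕ) : (assign s a).length = s.length := by
  cases s <;> simp [assign, List.orderedInsert_length]

theorem sorted_assign {s : List ℕ} (hs : s.Pairwise (· ≤ ·)) (a : ℕ) :
    (assign s a).Pairwise (· ≤ ·) := by
  cases s with
  | nil => simp [assign]
  | cons t s => exact hs.of_cons.orderedInsert _ _

theorem assign_mono {s s' : List ℕ} (h : List.Forall₂ (· ≤ ·) s s')
    (hs : s.Pairwise (· ≤ ·)) (hs' : s'.Pairwise (· ≤ ·)) (a : ℕ) :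
    List.Forall₂ (· ≤ ·) (assign s a) (assign s' a) := by
  cases h with
  | nil => exact .nil
  | cons hxy ht => exact orderedInsert_mono ht hs.of_cons hs'.of_cons (by omega)

theorem le_of_mem_assign {s : List ℕ} {c : ℕ} (h : ∀ x ∈ s, c ≤ x) (a : ℕ) :
    ∀ x ∈ assign s a, c ≤ x := by
  cases s with
  | nil => simp [assign]
  | cons t s =>
    intro x hx
    rcases (List.mem_orderedInsert _).1 hx with rfl | hx
    · have := h t (by simp)
      omega
    · exact h x (by simp [hx])

theorem length_foldl_assign (u s : List ℕ) : (u.foldl assign s).length = s.length := by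
  induction u generalizing s with
  | nil => rfl
  | cons a u ih => rw [List.foldl_cons, ih, length_assign]

theorem sorted_foldl_assign (u : List ℕ) {s : List ℕ} (hs : s.Pairwise (· ≤ ·)) :
    (u.foldl assign s).Pairwise (· ≤ ·) := by
  induction u generalizing s with
  | nil => exact hs
  | cons a u ih => exact ih (sorted_assign hs a)

theorem foldl_assign_mono (u : List ℕ) {s s' : List ℕ} (h : List.Forall₂ (· ≤ ·) s s')
    (hs : s.Pairwise (· ≤ ·)) (hs' : s'.Pairwise (· ≤ ·)) :
    List.Forall₂ (· ≤ ·) (u.foldl assign s) (u.foldl assign s') := by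
  induction u generalizing s s' with
  | nil => exact h
  | cons a u ih => exact ih (assign_mono h hs hs' a) (sorted_assign hs a) (sorted_assign hs' a)

theorem le_of_mem_foldl_assign (u : List ℕ) {s : List ℕ} {c : ℕ} (h : ∀ x ∈ s, c ≤ x) :
    ∀ x ∈ u.foldl assign s, c ≤ x := by
  induction u generalizing s with
  | nil => exact h
  | cons a u ih => exact ih (le_of_mem_assign h a)

theorem length_starts (s u : List ℕ) : (starts s u).length = u.length := by
  induction u generalizing s with
  | nil => rfl
  | cons a u ih => simp [starts, ih]

theorem le_of_mem_starts (u : List ℕ) {s : List ℕ} (hs : s ≠ []) {c : ℕ} (h : ∀ x ∈ s, c ≤ x) :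
    ∀ x ∈ starts s u, c ≤ x := by
  induction u generalizing s with
  | nil => simp [starts]
  | cons a u ih =>
    have hs' : assign s a ≠ [] := by
      rw [← List.length_pos_iff, length_assign]
      exact List.length_pos_iff.2 hs
    obtain ⟨t, s, rfl⟩ := List.exists_cons_of_ne_nil hs
    simp only [starts, List.headD_cons, List.forall_mem_cons]
    exact ⟨h t (by simp), ih hs' (le_of_mem_assign h a)⟩

theorem head_le_of_sorted {t : ℕ} {s : List ℕ} (hs : (t :: s).Pairwise (· ≤ ·)) :
    ∀ x ∈ t :: s, t ≤ x := by
  simpa using (List.pairwise_cons.1 hs).1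

theorem sorted_starts (u : List ℕ) {s : List ℕ} (hs : s.Pairwise (· ≤ ·)) (h0 : s ≠ []) :
    (starts s u).Pairwise (· ≤ ·) := by
  induction u generalizing s with
  | nil => simp [starts]
  | cons a u ih =>
    have hs' : assign s a ≠ [] := by
      rw [← List.length_pos_iff, length_assign]
      exact List.length_pos_iff.2 h0
    obtain ⟨t, s, rfl⟩ := List.exists_cons_of_ne_nil h0
    exact List.pairwise_cons.2 ⟨le_of_mem_starts u hs' (le_of_mem_assign (head_le_of_sorted hs) a),
      ih (sorted_assign hs a) hs'⟩

theorem starts_le (u : List ℕ) {s : List ℕ} (hs : s.Pairwise (· ≤ ·)) (h0 : s ≠ []) :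
    ∀ x ∈ starts s u, ∀ y ∈ u.foldl assign s, x ≤ y := by
  induction u generalizing s with
  | nil => simp [starts]
  | cons a u ih =>
    have hs' : assign s a ≠ [] := by
      rw [← List.length_pos_iff, length_assign]
      exact List.length_pos_iff.2 h0
    obtain ⟨t, s, rfl⟩ := List.exists_cons_of_ne_nil h0
    simp only [starts, List.headD_cons, List.forall_mem_cons]
    exact ⟨le_of_mem_foldl_assign (a :: u) (head_le_of_sorted hs), ih (sorted_assign hs a) hs'⟩

theorem starts_add_foldl_assign (u : List ℕ) {s : List ℕ} (h0 : s ≠ []) :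
    (starts s u : Multiset ℕ) + (u.foldl assign s : List ℕ) =
      (s : Multiset ℕ) + (List.zipWith (· + ·) (starts s u) u : List ℕ) := by
  induction u generalizing s with
  | nil => simp [starts]
  | cons a u ih =>
    have hs' : assign s a ≠ [] := by
      rw [← List.length_pos_iff, length_assign]
      exact List.length_pos_iff.2 h0
    obtain ⟨t, s, rfl⟩ := List.exists_cons_of_ne_nil h0
    have h : (assign (t :: s) a : Multiset ℕ) = (t + a) ::ₘ (s : Multiset ℕ) :=
      Multiset.coe_eq_coe.2 (List.perm_orderedInsert _ _ _)
    simp only [starts, List.headD_cons, List.foldl_cons, List.zipWith_cons_cons,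
      ← Multiset.cons_coe, Multiset.cons_add, Multiset.add_cons, ih hs', h, Multiset.cons_swap t]

theorem sum_foldl_assign (u : List ℕ) {s : List ℕ} (h0 : s ≠ []) :
    (u.foldl assign s).sum = s.sum + u.sum := by
  induction u generalizing s with
  | nil => simp
  | cons a u ih =>
    have hs' : assign s a ≠ [] := by
      rw [← List.length_pos_iff, length_assign]
      exact List.length_pos_iff.2 h0
    obtain ⟨t, s, rfl⟩ := List.exists_cons_of_ne_nil h0
    have h : (assign (t :: s) a).sum = t + a + s.sum := by
      simpa [assign] using (List.perm_orderedInsert (· ≤ ·) (t + a) s).sum_eq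
    rw [List.foldl_cons, ih hs', h, List.sum_cons, List.sum_cons]
    ring

/-- The free times of the machines after one period of length `m`, in which a machine free from
time `p` on is added, the jobs `u` are scheduled, and the machine that is free first is removed. -/
def periodMap (m p : ℕ) (u x : List ℕ) : List ℕ :=
  (u.foldl assign (x.orderedInsert (· ≤ ·) p)).tail.map (· - m)

theorem length_periodMap (m p : ℕ) (u x : List ℕ) : (periodMap m p u x).length = x.length := by
  simp [periodMap, length_foldl_assign, List.orderedInsert_length]

theorem sorted_periodMap (m p : ℕ) (u : List ℕ) {x : List ℕ} (hx : x.Pairwise (· ≤ ·)) :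
    (periodMap m p u x).Pairwise (· ≤ ·) := by
  refine List.Pairwise.map _ (fun a b (h : a ≤ b) => ?_)
    (sorted_foldl_assign u (hx.orderedInsert p _)).tail
  exact Nat.sub_le_sub_right h m

theorem periodMap_mono (m p : ℕ) (u : List ℕ) {x y : List ℕ} (h : List.Forall₂ (· ≤ ·) x y)
    (hx : x.Pairwise (· ≤ ·)) (hy : y.Pairwise (· ≤ ·)) :
    List.Forall₂ (· ≤ ·) (periodMap m p u x) (periodMap m p u y) := by
  have h1 := foldl_assign_mono u (orderedInsert_mono h hx hy (le_refl p))
    (hx.orderedInsert p _) (hy.orderedInsert p _)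
  rw [periodMap, periodMap, List.forall₂_map_left_iff, List.forall₂_map_right_iff]
  generalize u.foldl assign (x.orderedInsert (· ≤ ·) p) = v at h1 ⊢
  generalize u.foldl assign (y.orderedInsert (· ≤ ·) p) = w at h1 ⊢
  cases h1 with
  | nil => exact .nil
  | cons _ ht => exact ht.imp fun a b h => Nat.sub_le_sub_right h m

theorem orderedInsert_replicate {c L : ℕ} (h : c ≤ L) (q : ℕ) :
    (List.replicate q L).orderedInsert (· ≤ ·) c = c :: List.replicate q L := by
  cases q with
  | zero => rfl
  | succ q => exact List.orderedInsert_cons_of_le _ _ h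

theorem foldl_assign_replicate (u : List ℕ) {c L : ℕ} (h : c + u.sum ≤ L) (q : ℕ) :
    u.foldl assign (c :: List.replicate q L) = (c + u.sum) :: List.replicate q L := by
  induction u generalizing c with
  | nil => simp
  | cons a u ih =>
    rw [List.sum_cons, ← add_assoc] at *
    rw [List.foldl_cons, assign, orderedInsert_replicate (by omega), ih h]

theorem eq_of_forall₂_le_of_sum_le {x y : List ℕ} (h : List.Forall₂ (· ≤ ·) x y)
    (hs : y.sum ≤ x.sum) : x = y := by
  induction h with
  | nil => rfl
  | cons hab ht ih =>
    have := ht.sum_le_sum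
    simp only [List.sum_cons] at hs
    rw [ih (by omega), show _ = _ from le_antisymm hab (by omega)]

theorem exists_periodMap_eq (m p : ℕ) (u : List ℕ) (q : ℕ) :
    ∃ x : List ℕ, x.Pairwise (· ≤ ·) ∧ x.length = q ∧ periodMap m p u x = x := by
  have hne : ∃ n, ∃ x : List ℕ, x.sum = n ∧ x.Pairwise (· ≤ ·) ∧ x.length = q ∧
      List.Forall₂ (· ≤ ·) (periodMap m p u x) x := by
    refine ⟨_, List.replicate q (p + u.sum), rfl, List.pairwise_replicate.2 (by simp), by simp, ?_⟩
    rw [periodMap, orderedInsert_replicate (by omega), foldl_assign_replicate u le_rfl,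
      List.tail_cons, List.map_replicate]
    exact List.forall₂_iff_get.2 ⟨by simp, by simp⟩
  classical
  obtain ⟨x, hxs, hx, hxl, hle⟩ := Nat.find_spec hne
  refine ⟨x, hx, hxl, eq_of_forall₂_le_of_sum_le hle ?_⟩
  rw [hxs]
  exact Nat.find_min' hne ⟨_, rfl, sorted_periodMap m p u hx, by rw [length_periodMap, hxl],
    periodMap_mono m p u hle (sorted_periodMap m p u hx) hx⟩

theorem sum_le_sum_map_sub (m : ℕ) (l : List ℕ) :
    l.sum ≤ (l.map (· - m)).sum + l.length * m := by
  induction l with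
  | nil => simp
  | cons a l ih =>
    simp only [List.sum_cons, List.map_cons, List.length_cons, add_mul, one_mul]
    omega

theorem le_of_sum_eq_sum_map_sub {m : ℕ} {l : List ℕ}
    (h : (l.map (· - m)).sum + l.length * m ≤ l.sum) : ∀ a ∈ l, m ≤ a := by
  induction l with
  | nil => simp
  | cons a l ih =>
    have := sum_le_sum_map_sub m l
    simp only [List.sum_cons, List.map_cons, List.length_cons, add_mul, one_mul] at h
    simp only [List.forall_mem_cons]
    exact ⟨by omega, ih (by omega)⟩

theorem sum_map_sub {m : ℕ} {l : List ℕ} (h : ∀ a ∈ l, m ≤ a) :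
    l.sum = (l.map (· - m)).sum + l.length * m := by
  induction l with
  | nil => simp
  | cons a l ih =>
    rw [List.forall_mem_cons] at h
    have := ih h.2
    simp only [List.sum_cons, List.map_cons, List.length_cons, add_mul, one_mul]
    omega

/-- Jobs filling exactly `q + 1` machines, up to one unit and the late start `p` of one machine,
admit a schedule that repeats with period `m`. -/
theorem exists_periodic_schedule {m p q : ℕ} {u : List ℕ} (h : p + u.sum + 1 = (q + 1) * m) :
    ∃ s x : List ℕ, s.Pairwise (· ≤ ·) ∧ s ≠ [] ∧ (s : Multiset ℕ) = p ::ₘ (x : Multiset ℕ) ∧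
      u.foldl assign s = (m - 1) :: x.map (· + m) := by
  have hm0 : 0 < m := Nat.pos_of_ne_zero fun h0 => by simp [h0] at h
  obtain ⟨x, hx, hxl, hfix⟩ := exists_periodMap_eq m p u q
  have hperm := List.perm_orderedInsert (· ≤ ·) p x
  have hs0 : x.orderedInsert (· ≤ ·) p ≠ [] := by
    rw [← List.length_pos_iff, List.orderedInsert_length]
    omega
  refine ⟨x.orderedInsert (· ≤ ·) p, x, hx.orderedInsert p _, hs0, Multiset.coe_eq_coe.2 hperm, ?_⟩
  have hsum := sum_foldl_assign u hs0
  have hlen := length_foldl_assign u (x.orderedInsert (· ≤ ·) p)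
  have hsort := sorted_foldl_assign u (hx.orderedInsert p _)
  rw [hperm.sum_eq] at hsum
  rw [List.orderedInsert_length] at hlen
  unfold periodMap at hfix
  generalize u.foldl assign (x.orderedInsert (· ≤ ·) p) = y at *
  cases y with
  | nil => simp at hlen
  | cons c ys =>
    simp only [List.tail_cons, List.length_cons, List.sum_cons, add_mul, one_mul] at *
    have hyl : ys.length * m = q * m := by rw [← hxl, Nat.succ_injective hlen]
    have hc := (List.pairwise_cons.1 hsort).1
    have h1 := sum_le_sum_map_sub m ys
    rw [hfix, hyl] at h1
    have hcm : c = m - 1 := by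
      by_cases hcm : m ≤ c
      · have h2 := sum_map_sub fun a ha => hcm.trans (hc a ha)
        rw [hfix, hyl] at h2
        omega
      · omega
    have hm : ∀ a ∈ ys, m ≤ a := by
      refine le_of_sum_eq_sum_map_sub ?_
      rw [hfix, hyl]
      omega
    rw [hcm, ← hfix, List.map_map]
    congr 1
    conv_lhs => rw [← List.map_id ys]
    exact List.map_congr_left fun a ha => (Nat.sub_add_cancel (hm a ha)).symm

end Scheduling

theorem flatMap_filter_eq {α : Type*} (l : List (ℕ × α))
    (hl : l.Pairwise (fun e e' => e.1 ≤ e'.1)) (n : ℕ) :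
    (List.range n).flatMap (fun t => l.filter (fun e => e.1 = t)) =
      l.filter (fun e => e.1 < n) := by
  induction n with
  | zero => simp
  | succ n ih =>
    rw [List.range_succ, List.flatMap_append, ih, List.flatMap_singleton]
    clear ih
    induction l with
    | nil => rfl
    | cons e l ih =>
      have h := (List.pairwise_cons.1 hl).1
      specialize ih hl.of_cons
      rcases lt_trichotomy e.1 n with he | he | he
      · simp [he, he.ne, he.le, ih]
      · have h0 : l.filter (fun e => e.1 < n) = [] := by
          rw [List.filter_eq_nil_iff]
          intro e' he'
          have := h e' he'
          simp
          omega
        rw [h0, List.nil_append] at ih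
        simp [he, h0, ih]
      · simp [he, he.ne', he.not_gt, ih]

section Blocks

variable {m : ℕ}

/-- The block met at time `t`: blocks are met in the order `m - 1, …, 0`, periodically. -/
def blockAt (m : ℕ) [NeZero m] (t : ℕ) : Fin m :=
  -Fin.ofNat m (t + 1)

theorem ofNat_add [NeZero m] (a b : ℕ) : Fin.ofNat m (a + b) = Fin.ofNat m a + Fin.ofNat m b := by
  ext
  simp [Fin.val_add]

theorem ofNat_self_eq_zero [NeZero m] : Fin.ofNat m m = 0 := by
  ext
  simp

theorem blockAt_add_val [NeZero m] (t : ℕ) (a : Fin m) : blockAt m (t + a) = blockAt m t - a := by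
  rw [blockAt, blockAt, add_right_comm, ofNat_add, Fin.ofNat_val_eq_self, neg_add, sub_eq_add_neg]

theorem blockAt_add_self [NeZero m] (t : ℕ) : blockAt m (t + m) = blockAt m t := by
  rw [blockAt, blockAt, add_right_comm, ofNat_add, ofNat_self_eq_zero, add_zero]

theorem blockAt_pred_sub [NeZero m] {r : ℕ} (hr : r < m) :
    blockAt m (m - 1 - r) = Fin.ofNat m r := by
  refine (eq_neg_of_add_eq_zero_left ?_).symm
  rw [← ofNat_add, show r + (m - 1 - r + 1) = m by omega, ofNat_self_eq_zero]

theorem blockAt_eq_rev_iff [NeZero m] {t : ℕ} (ht : t < m) (i : Fin m) :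
    blockAt m t = Fin.rev i ↔ t = i.val := by
  have h := blockAt_pred_sub (m := m) (r := m - 1 - t) (by omega)
  rw [show m - 1 - (m - 1 - t) = t by omega] at h
  rw [h, Fin.ext_iff, Fin.val_ofNat, Fin.val_rev, Nat.mod_eq_of_lt (by omega)]
  omega

theorem ofNat_sum_val [NeZero m] (u : List (Fin m)) : Fin.ofNat m (u.map Fin.val).sum = u.sum := by
  induction u with
  | nil => rfl
  | cons a u ih => rw [List.map_cons, List.sum_cons, List.sum_cons, ofNat_add, ih,
      Fin.ofNat_val_eq_self]

theorem sum_filter_fst {α : Type*} (s : Multiset (Fin m × α)) :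
    ∑ k, s.filter (fun e => e.1 = k) = s := by
  induction s using Multiset.induction_on with
  | empty => simp
  | cons e s ih =>
    have h (k : Fin m) : (e ::ₘ s).filter (fun e => e.1 = k) =
        (if e.1 = k then {e} else 0) + s.filter (fun e => e.1 = k) := by
      rw [Multiset.filter_cons]
    simp only [h, Finset.sum_add_distrib, ih]
    simp

/-- The partition that puts each letter of a list of pairs (time, letter) into the block met at
that time. -/
def timedPartition [NeZero m] (L : List (ℕ × Fin m)) (k : Fin m) : List (Fin m) :=
  (L.filter (fun e => blockAt m e.1 = k)).map Prod.snd

theorem forget_timedPartition [NeZero m] {L : List (ℕ × Fin m)}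
    (hL : L.Pairwise (fun e e' => e.1 ≤ e'.1))
    (hm : ∀ e ∈ L, e.1 < m) : forget (timedPartition L) = L.map Prod.snd := by
  have h (i : Fin m) : timedPartition L (Fin.rev i) =
      (L.filter (fun e => e.1 = i.val)).map Prod.snd := by
    unfold timedPartition
    congr 1
    exact List.filter_congr fun e he => by simp [blockAt_eq_rev_iff (hm e he)]
  have h' := flatMap_filter_eq L hL m
  rw [List.filter_eq_self.2 (by simpa using hm), ← List.map_coe_finRange_eq_range,
    List.flatMap_map] at h'
  rw [forget, List.finRange_reverse, List.flatMap_map]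
  simp only [h]
  rw [← List.map_flatMap, h']

theorem edges_timedPartition [NeZero m] (L : List (ℕ × Fin m)) :
    edges (timedPartition L) = (L.map (fun e => (blockAt m e.1, e.2)) : List (Fin m × Fin m)) := by
  rw [← sum_filter_fst (L.map (fun e => (blockAt m e.1, e.2)) : Multiset (Fin m × Fin m))]
  refine Finset.sum_congr rfl fun k _ => ?_
  simp only [timedPartition, Multiset.map_coe, Multiset.filter_coe, List.map_map, List.filter_map]
  congr 1
  refine List.map_congr_left fun e he => ?_
  simp only [List.mem_filter, decide_eq_true_eq] at he
  simp [he.2]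

theorem exists_degreeBalanced [NeZero m] (u : List (Fin m)) :
    ∃ P : Fin m → List (Fin m), forget P = u ∧ DegreeBalanced P u.sum := by
  have hm : 0 < m := Nat.pos_of_neZero m
  set v := u.map Fin.val with hv
  have hr := Nat.mod_lt v.sum hm
  obtain ⟨s, x, hs, hs0, hsx, hfold⟩ := exists_periodic_schedule (m := m) (p := m - 1 - v.sum % m)
    (q := v.sum / m) (u := v) (by
      have := Nat.div_add_mod v.sum m
      rw [add_mul, one_mul, mul_comm]
      omega)
  have hlen : (starts s v).length = u.length := by rw [length_starts, hv, List.length_map]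
  have hfst : ((starts s v).zip u).map Prod.fst = starts s v := List.map_fst_zip hlen.le
  have hsnd : ((starts s v).zip u).map Prod.snd = u := List.map_snd_zip hlen.ge
  have hforget : forget (timedPartition ((starts s v).zip u)) = u := by
    rw [forget_timedPartition, hsnd]
    · rw [← List.pairwise_map (f := Prod.fst) (R := (· ≤ ·)), hfst]
      exact sorted_starts v hs hs0
    · intro e he
      have h1 : e.1 ∈ starts s v := by
        rw [← hfst]
        exact List.mem_map_of_mem he
      have := starts_le v hs hs0 _ h1 (m - 1) (by simp [hfold])
      omega
  refine ⟨_, hforget, ?_⟩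
  have hbal := congrArg (Multiset.map (blockAt m)) (starts_add_foldl_assign v hs0)
  have hp : blockAt m (m - 1 - v.sum % m) = u.sum := by
    rw [blockAt_pred_sub hr, ← ofNat_sum_val]
    ext
    simp [hv]
  have h0 : blockAt m (m - 1) = 0 := by
    have := blockAt_pred_sub hm
    simpa using this
  have hzip : (List.zipWith (· + ·) (starts s v) v).map (blockAt m) =
      ((starts s v).zip u).map (fun e => blockAt m e.1 - e.2) := by
    rw [hv, List.zipWith_map_right, List.map_zipWith]
    simp only [blockAt_add_val]
    exact List.map_uncurry_zip_eq_zipWith.symm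
  have hx : ((x.map (· + m)).map (blockAt m)) = x.map (blockAt m) := by
    simp [blockAt_add_self]
  rw [hfold, hsx] at hbal
  simp only [Multiset.map_add, ← Multiset.cons_coe, Multiset.map_cons, Multiset.map_coe, hp, h0,
    hzip, hx, Multiset.cons_add, Multiset.add_cons] at hbal
  unfold DegreeBalanced
  rw [edges_timedPartition, Multiset.map_coe, Multiset.map_coe, List.map_map, List.map_map]
  have hst : ((starts s v).zip u).map (Prod.fst ∘ fun e => (blockAt m e.1, e.2)) =
      (starts s v).map (blockAt m) := by
    conv_rhs => rw [← hfst]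
    rw [List.map_map]
    rfl
  rw [hst]
  refine add_right_cancel (b := (x.map (blockAt m) : Multiset (Fin m))) ?_
  rw [add_right_comm, Multiset.add_comm _ {0}, Multiset.singleton_add, hbal, add_right_comm,
    Multiset.add_comm _ {u.sum}, Multiset.singleton_add]
  exact congrArg _ (Multiset.add_comm _ _)

end Blocks

/-- Every word u ∈ A admits at least one successful partition. -/
theorem exists_successful_partition (m N : ℕ) [NeZero m] (u : List (Fin m))
    (hu : u.length = N) :
    ∃ P : Fin m → List (Fin m), forget P = u ∧ (invPresweep N P).isSome := by
  obtain ⟨P, rfl, hP⟩ := exists_degreeBalanced u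
  subst hu
  exact exists_isSome_of_balanced P hP
end

section
/- Every word u ∈ A admits exactly one successful partition; that is, the forgetful map forget : A* → A, restricted to successful partitions, is a bijection onto A. -/
/-- The partitioned word from which the inverse presweep algorithm removes the letters of `r`,
in this order. -/
def ofRemovals {m : ℕ} [NeZero m] : List (Fin m) → Fin m → List (Fin m)
  | [] => fun _ => []
  | a :: r => Function.update (ofRemovals r) (a :: r).sum (a :: ofRemovals r (a :: r).sum)

/-- The letters of `forget P`, each paired with the index of its block. -/
def labelled {m : ℕ} (P : Fin m → List (Fin m)) : List (Fin m × Fin m) :=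
  (List.finRange m).reverse.flatMap fun k => (P k).map (Prod.mk k)

/-- The letters of `r`, each paired with the level at which the algorithm removes it. -/
def removalSteps {m : ℕ} [NeZero m] : List (Fin m) → List (Fin m × Fin m)
  | [] => []
  | a :: r => ((a :: r).sum, a) :: removalSteps r

/-- The distance from `v` up to `x` around the cycle `Fin m`. -/
def cyclicDist {m : ℕ} (v x : Fin m) : ℤ := ((x - v : Fin m) : ℕ)

section Labelled

variable {m : ℕ}

lemma map_snd_labelled (P : Fin m → List (Fin m)) : (labelled P).map Prod.snd = forget P := by
  simp [labelled, forget, List.map_flatMap, Function.comp_def]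

lemma filter_labelled (P : Fin m → List (Fin m)) (k : Fin m) :
    (labelled P).filter (fun x => x.1 = k) = (P k).map (Prod.mk k) := by
  have h : ∀ l : List (Fin m), l.Nodup →
      (l.flatMap fun j => (P j).map (Prod.mk j)).filter (fun x => x.1 = k) =
        if k ∈ l then (P k).map (Prod.mk k) else [] := by
    intro l hl
    induction l with
    | nil => simp
    | cons j l ih =>
      rw [List.nodup_cons] at hl
      rw [List.flatMap_cons, List.filter_append, ih hl.2, List.filter_map]
      by_cases hjk : j = k
      · subst hjk
        simp [hl.1, Function.comp_def]
      · simp [hjk, Ne.symm hjk, Function.comp_def]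
  simpa [labelled] using h _ (List.nodup_reverse.2 (List.nodup_finRange m))

lemma labelled_injective : Function.Injective (labelled (m := m)) := by
  intro P Q h
  funext k
  have hk := filter_labelled P k
  rw [h, filter_labelled] at hk
  exact ((List.map_injective_iff.2 (Prod.mk_right_injective k)) hk).symm

lemma pairwise_labelled (P : Fin m → List (Fin m)) :
    (labelled P).Pairwise fun x y => y.1 ≤ x.1 := by
  rw [labelled, List.pairwise_flatMap]
  constructor
  · intro k _
    simp [List.pairwise_iff_getElem]
  · rw [List.pairwise_reverse]
    refine (List.pairwise_lt_finRange m).imp ?_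
    intro j k hjk x hx y hy
    simp only [List.mem_map] at hx hy
    obtain ⟨_, _, rfl⟩ := hx
    obtain ⟨_, _, rfl⟩ := hy
    exact hjk.le

lemma labelled_update_cons_perm (P : Fin m → List (Fin m)) (k a : Fin m) :
    (labelled (Function.update P k (a :: P k))).Perm ((k, a) :: labelled P) := by
  have h : ∀ l : List (Fin m), l.Nodup →
      (l.flatMap fun j => (Function.update P k (a :: P k) j).map (Prod.mk j)).Perm
        ((if k ∈ l then [(k, a)] else []) ++ l.flatMap fun j => (P j).map (Prod.mk j)) := by
    intro l hl
    induction l with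
    | nil => simp
    | cons j l ih =>
      rw [List.nodup_cons] at hl
      specialize ih hl.2
      by_cases hjk : j = k
      · subst hjk
        simpa [hl.1] using ih.append_left ((P j).map (Prod.mk j))
      · simp only [List.flatMap_cons, Function.update_of_ne hjk, List.mem_cons, Ne.symm hjk,
          false_or]
        refine (ih.append_left _).trans ?_
        rw [← List.append_assoc, ← List.append_assoc]
        exact List.perm_append_comm.append_right _
  simpa [labelled] using h _ (List.nodup_reverse.2 (List.nodup_finRange m))

lemma forget_update_cons_perm (P : Fin m → List (Fin m)) (k a : Fin m) :
    (forget (Function.update P k (a :: P k))).Perm (a :: forget P) := by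
  simpa [map_snd_labelled] using (labelled_update_cons_perm P k a).map Prod.snd

end Labelled

section Removals

variable {m : ℕ} [NeZero m]

lemma labelled_ofRemovals_perm (r : List (Fin m)) :
    (labelled (ofRemovals r)).Perm (removalSteps r) := by
  induction r with
  | nil => simp [labelled, ofRemovals, removalSteps]
  | cons a r ih => exact (labelled_update_cons_perm _ _ _).trans (ih.cons _)

lemma forget_ofRemovals_perm (r : List (Fin m)) : (forget (ofRemovals r)).Perm r := by
  induction r with
  | nil => simp [forget, ofRemovals]
  | cons a r ih => exact (forget_update_cons_perm _ _ _).trans (ih.cons _)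

lemma invPresweepAux_ofRemovals (r : List (Fin m)) :
    invPresweepAux r.length (ofRemovals r) r.sum = some r := by
  induction r with
  | nil => simp [invPresweepAux]
  | cons a r ih =>
    simp only [List.length_cons, invPresweepAux, ofRemovals, Function.update_self,
      Function.update_idem, Function.update_eq_self]
    rw [List.sum_cons, add_sub_cancel_left, ih]
    rfl

lemma invPresweep_ofRemovals (r : List (Fin m)) :
    invPresweep r.length (ofRemovals r) = some r.reverse := by
  rw [invPresweep, (forget_ofRemovals_perm r).sum_eq, invPresweepAux_ofRemovals]
  rfl

lemma eq_ofRemovals_of_invPresweepAux {n : ℕ} {P : Fin m → List (Fin m)} {r : List (Fin m)}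
    (hn : (forget P).length = n) (h : invPresweepAux n P (forget P).sum = some r) :
    P = ofRemovals r := by
  induction n generalizing P r with
  | zero =>
    simp only [invPresweepAux, Option.some.injEq] at h
    subst h
    rw [List.length_eq_zero_iff, forget, List.flatMap_eq_nil_iff] at hn
    funext k
    exact hn k (by simp)
  | succ n ih =>
    rw [invPresweepAux] at h
    split at h
    · simp at h
    · rename_i a rest hP
      set s := (forget P).sum with hs
      set Q := Function.update P s rest with hQ
      have hPQ : P = Function.update Q s (a :: Q s) := by simp [hQ, ← hP]
      have hperm : (forget P).Perm (a :: forget Q) := by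
        conv_lhs => rw [hPQ]
        exact forget_update_cons_perm Q s a
      have hsum : s = a + (forget Q).sum := by rw [hs, hperm.sum_eq, List.sum_cons]
      obtain ⟨r', hr', rfl⟩ := Option.map_eq_some_iff.1 h
      have hQr : Q = ofRemovals r' := by
        refine ih ?_ ?_
        · have := hperm.length_eq
          simp only [List.length_cons] at this
          omega
        · rwa [hsum, add_sub_cancel_left] at hr'
      have hsr : s = (a :: r').sum := by
        rw [hsum, hQr, (forget_ofRemovals_perm r').sum_eq, List.sum_cons]
      rw [hPQ, hQr, hsr, ofRemovals]

/-- Following the last letters of the nonempty blocks of a successful partition leads to `0`. -/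
lemma ofRemovals_eq_nil_of_closed {r : List (Fin m)} {K : Set (Fin m)} (h0 : 0 ∉ K)
    (hK : ∀ k ∈ K, ∀ l a, ofRemovals r k = l ++ [a] → k - a ∈ K) :
    ∀ k ∈ K, ofRemovals r k = [] := by
  induction r with
  | nil => simp [ofRemovals]
  | cons a r ih =>
    have hr : ∀ k ∈ K, ofRemovals r k = [] := by
      refine ih fun k hk l b hb => ?_
      by_cases hks : k = (a :: r).sum
      · refine hK k hk (a :: l) b ?_
        rw [hks] at hb
        rw [ofRemovals, hks, Function.update_self, hb, List.cons_append]
      · exact hK k hk l b (by rw [ofRemovals, Function.update_of_ne hks, hb])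
    intro k hk
    by_cases hks : k = (a :: r).sum
    · exfalso
      have hmem : r.sum ∈ K := by
        have := hK k hk [] a
          (by rw [ofRemovals, ← hks, Function.update_self, hr k hk, List.nil_append])
        rwa [hks, List.sum_cons, add_sub_cancel_left] at this
      cases r with
      | nil => exact h0 (by simpa using hmem)
      | cons b r =>
        have := hr _ hmem
        simp [ofRemovals] at this
    · rw [ofRemovals, Function.update_of_ne hks, hr k hk]

lemma sum_removalSteps (r : List (Fin m)) (v : Fin m) :
    ((removalSteps r).map fun x => cyclicDist (v + x.2) x.1 - cyclicDist v x.1).sum =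
      cyclicDist v 0 - cyclicDist v r.sum := by
  induction r with
  | nil => simp [removalSteps]
  | cons a r ih =>
    have h : cyclicDist (v + a) (a + r.sum) = cyclicDist v r.sum := by
      rw [cyclicDist, cyclicDist, add_comm v a, add_sub_add_left_eq_sub]
    simp only [removalSteps, List.map_cons, List.sum_cons, ih, h]
    ring

end Removals

section Balance

variable {m n : ℕ}

lemma cyclicDist_of_le {r p : Fin m} (h : r ≤ p) (v : Fin m) :
    cyclicDist v r = cyclicDist v p - ((p : ℕ) - (r : ℕ)) + m * if r < v ∧ v ≤ p then 1 else 0 := by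
  have key : ∀ x : Fin m, cyclicDist v x = (x : ℕ) - (v : ℕ) + if x < v then (m : ℤ) else 0 := by
    intro x
    rw [cyclicDist]
    split_ifs with hx
    · rw [Fin.coe_sub_iff_lt.2 hx]
      have := v.isLt
      push_cast [show (v : ℕ) ≤ m + x by omega]
      ring
    · rw [Fin.coe_sub_iff_le.2 (not_lt.1 hx)]
      have : (v : ℕ) ≤ x := not_lt.1 hx
      push_cast [this]
      ring
  rw [key r, key p]
  split_ifs <;> simp only [Fin.lt_def, Fin.le_def] at * <;> omega

/-- The winding imbalance at `v` of the steps from `p i` to `p i - a i`. -/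
def imbalance (a p : Fin n → Fin m) (v : Fin m) : ℤ :=
  ∑ i, (cyclicDist (v + a i) (p i) - cyclicDist v (p i))

lemma sum_imbalance [NeZero m] (a p : Fin n → Fin m) : ∑ v, imbalance a p v = 0 := by
  simp only [imbalance]
  rw [Finset.sum_comm]
  refine Finset.sum_eq_zero fun i _ => ?_
  rw [Finset.sum_sub_distrib, sub_eq_zero]
  exact Equiv.sum_comp (Equiv.addRight (a i)) fun v => cyclicDist v (p i)

lemma imbalance_of_le {a p r : Fin n → Fin m} (h : r ≤ p) {v : Fin m}
    (hv : ∀ i, ¬(r i < v ∧ v ≤ p i)) :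
    imbalance a r v =
      imbalance a p v + m * ∑ i, if r i < v + a i ∧ v + a i ≤ p i then 1 else 0 := by
  simp only [imbalance, Finset.mul_sum, ← Finset.sum_add_distrib]
  refine Finset.sum_congr rfl fun i _ => ?_
  rw [cyclicDist_of_le (h i) (v + a i), cyclicDist_of_le (h i) v, if_neg (hv i)]
  ring

lemma imbalance_le_of_le {a p r : Fin n → Fin m} (h : r ≤ p) {v : Fin m}
    (hv : ∀ i, ¬(r i < v ∧ v ≤ p i)) : imbalance a p v ≤ imbalance a r v := by
  rw [imbalance_of_le h hv]
  exact le_add_of_nonneg_right (mul_nonneg (by positivity)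
    (Finset.sum_nonneg fun i _ => by split_ifs <;> simp))

lemma closed_of_imbalance_eq [NeZero m] {a p q : Fin n → Fin m} (hp : Antitone p) (hq : Antitone q)
    (h : imbalance a p = imbalance a q) {i : Fin n} {k : Fin m} (hqk : q i < k) (hkp : k ≤ p i) :
    ∃ j, q j < k - a i ∧ k - a i ≤ p j := by
  by_contra! hv
  have hle : ∀ v, imbalance a p v ≤ imbalance a (p ⊓ q) v := by
    intro v
    by_cases hK : ∃ j, q j < v ∧ v ≤ p j
    · obtain ⟨j, hqj, hpj⟩ := hK
      rw [h]
      refine imbalance_le_of_le inf_le_right fun j' hj' => ?_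
      have hpj' : p j' < v := by
        rcases inf_lt_iff.1 hj'.1 with h1 | h1
        · exact h1
        · exact absurd hj'.2 (not_le.2 h1)
      rcases le_total j j' with hjj | hjj
      · exact absurd (hj'.2.trans (hq hjj)) (not_le.2 hqj)
      · exact absurd (hpj.trans (hp hjj)) (not_le.2 hpj')
    · push Not at hK
      refine imbalance_le_of_le inf_le_left fun j hj => ?_
      rcases inf_lt_iff.1 hj.1 with h1 | h1
      · exact absurd hj.2 (not_le.2 h1)
      · exact absurd hj.2 (not_le.2 (hK j h1))
  have hlt : imbalance a p (k - a i) < imbalance a (p ⊓ q) (k - a i) := by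
    rw [imbalance_of_le (p := p) inf_le_left]
    · refine lt_add_of_pos_right _ (mul_pos (by exact_mod_cast NeZero.pos m) ?_)
      refine Finset.sum_pos' (fun j _ => by split_ifs <;> simp) ⟨i, Finset.mem_univ i, ?_⟩
      rw [sub_add_cancel, if_pos ⟨inf_lt_iff.2 (Or.inr hqk), hkp⟩]
      exact one_pos
    · intro j hj
      rcases inf_lt_iff.1 hj.1 with h1 | h1
      · exact absurd hj.2 (not_le.2 h1)
      · exact absurd hj.2 (not_le.2 (hv j h1))
  have := Finset.sum_lt_sum (fun v _ => hle v) ⟨_, Finset.mem_univ _, hlt⟩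
  simp [sum_imbalance] at this

end Balance

section Injectivity

variable {m : ℕ}

lemma exists_ofFn_of_map_snd_eq {α β : Type*} {X Y : List (α × β)}
    (h : X.map Prod.snd = Y.map Prod.snd) :
    ∃ (n : ℕ) (p q : Fin n → α) (a : Fin n → β),
      X = List.ofFn (fun i => (p i, a i)) ∧ Y = List.ofFn fun i => (q i, a i) := by
  have hlen : X.length = Y.length := by simpa using congrArg List.length h
  refine ⟨X.length, fun i => (X[i]).1, fun i => (Y[i]).1, fun i => (X[i]).2, ?_, ?_⟩
  · simp
  · refine List.ext_getElem (by simp [hlen]) fun i h1 h2 => ?_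
    have h3 : (X.map Prod.snd)[i]'(by simp; omega) = (Y.map Prod.snd)[i]'(by simpa) := by
      simp only [h]
    simp only [List.getElem_map] at h3
    simp [h3]

lemma antitone_of_labelled_eq_ofFn {n : ℕ} {P : Fin m → List (Fin m)} {p a : Fin n → Fin m}
    (h : labelled P = List.ofFn fun i => (p i, a i)) : Antitone p := by
  have := pairwise_labelled P
  rw [h, List.pairwise_ofFn] at this
  exact antitone_iff_forall_lt.2 fun i j hij => this hij

/-- The position of the last letter of a block. -/
lemma exists_last_of_labelled_eq_ofFn {n : ℕ} {P : Fin m → List (Fin m)} {p a : Fin n → Fin m}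
    (h : labelled P = List.ofFn fun i => (p i, a i)) {k b : Fin m} {l : List (Fin m)}
    (hl : P k = l ++ [b]) : ∃ i, p i = k ∧ a i = b ∧ ∀ j, i < j → p j < k := by
  have hp := antitone_of_labelled_eq_ofFn h
  have hf := filter_labelled P k
  rw [hl, List.map_append, List.filter_eq_append_iff] at hf
  obtain ⟨l₁, l₂, hX, -, hl₂⟩ := hf
  rw [List.map_singleton, List.filter_eq_cons_iff] at hl₂
  obtain ⟨l₃, l₄, rfl, -, -, hl₄⟩ := hl₂
  rw [← List.append_assoc] at hX
  set l₅ := l₁ ++ l₃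
  rw [h] at hX
  have hlen : n = l₅.length + (l₄.length + 1) := by simpa using congrArg List.length hX
  have hget : ∀ j : Fin n, (l₅ ++ (k, b) :: l₄)[(j : ℕ)]'(by simp; omega) = (p j, a j) := by
    intro j
    simp [← hX]
  let i : Fin n := ⟨l₅.length, by omega⟩
  have hi : (k, b) = (p i, a i) := by
    rw [← hget i]
    simp [i]
  rw [Prod.mk.injEq] at hi
  refine ⟨i, hi.1.symm, hi.2.symm, fun j hij => ?_⟩
  refine lt_of_le_of_ne ((hp hij.le).trans_eq hi.1.symm) fun hjk => ?_
  have hmem : (p j, a j) ∈ l₄ := by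
    have hij' : l₅.length < (j : ℕ) := hij
    have hj := hget j
    rw [List.getElem_append_right hij'.le, List.getElem_cons, dif_neg (by omega)] at hj
    rw [← hj]
    exact List.getElem_mem _
  exact List.filter_eq_nil_iff.1 hl₄ _ hmem (by simpa using hjk)

variable [NeZero m]

lemma imbalance_of_labelled_eq_ofFn {n : ℕ} {r : List (Fin m)} {p a : Fin n → Fin m}
    (h : labelled (ofRemovals r) = List.ofFn fun i => (p i, a i)) (v : Fin m) :
    imbalance a p v = cyclicDist v 0 - cyclicDist v r.sum := by
  rw [← sum_removalSteps, ← ((labelled_ofRemovals_perm r).map _).sum_eq, h, List.map_ofFn,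
    List.sum_ofFn]
  rfl

lemma le_of_labelled_eq_ofFn {n : ℕ} {r r' : List (Fin m)} {p q a : Fin n → Fin m}
    (hsum : r.sum = r'.sum)
    (hp : labelled (ofRemovals r) = List.ofFn fun i => (p i, a i))
    (hq : labelled (ofRemovals r') = List.ofFn fun i => (q i, a i)) : p ≤ q := by
  have hpa := antitone_of_labelled_eq_ofFn hp
  have hqa := antitone_of_labelled_eq_ofFn hq
  have hbal : imbalance a p = imbalance a q := by
    funext v
    rw [imbalance_of_labelled_eq_ofFn hp, imbalance_of_labelled_eq_ofFn hq, hsum]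
  have hnil : ∀ k ∈ {k | ∃ i, q i < k ∧ k ≤ p i}, ofRemovals r k = [] := by
    refine ofRemovals_eq_nil_of_closed (fun ⟨i, hi, _⟩ => absurd hi (not_lt.2 (Fin.zero_le _))) ?_
    rintro k ⟨i, hqi, hpi⟩ l b hl
    obtain ⟨j, rfl, rfl, hj⟩ := exists_last_of_labelled_eq_ofFn hp hl
    have hij : i ≤ j := not_lt.1 fun hji => absurd (hj i hji) (not_lt.2 hpi)
    exact closed_of_imbalance_eq hpa hqa hbal ((hqa hij).trans_lt hqi) le_rfl
  intro i
  by_contra hi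
  have hmem : (p i, a i) ∈ (labelled (ofRemovals r)).filter (fun x => x.1 = p i) := by
    simp only [hp, List.mem_filter, List.mem_ofFn]
    exact ⟨⟨i, rfl⟩, by simp⟩
  rw [filter_labelled, hnil (p i) ⟨i, not_le.1 hi, le_rfl⟩] at hmem
  simp at hmem

lemma forget_ofRemovals_injective :
    Function.Injective fun r : List (Fin m) => forget (ofRemovals r) := by
  intro r r' (h : forget (ofRemovals r) = forget (ofRemovals r'))
  have hperm : r.Perm r' := by
    have := forget_ofRemovals_perm r
    rw [h] at this
    exact this.symm.trans (forget_ofRemovals_perm r')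
  rw [← map_snd_labelled, ← map_snd_labelled] at h
  obtain ⟨n, p, q, a, hp, hq⟩ := exists_ofFn_of_map_snd_eq h
  have hpq : p = q :=
    le_antisymm (le_of_labelled_eq_ofFn hperm.sum_eq hp hq)
      (le_of_labelled_eq_ofFn hperm.sum_eq.symm hq hp)
  have hP : ofRemovals r = ofRemovals r' := labelled_injective (by rw [hp, hq, hpq])
  have hr := invPresweep_ofRemovals r
  rw [hP, hperm.length_eq, invPresweep_ofRemovals] at hr
  exact (List.reverse_injective (Option.some.inj hr)).symm

lemma exists_forget_ofRemovals_eq (u : List (Fin m)) :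
    ∃ r : List (Fin m), r.length = u.length ∧ forget (ofRemovals r) = u := by
  let f : List.Vector (Fin m) u.length → List.Vector (Fin m) u.length := fun r =>
    ⟨forget (ofRemovals r.1), (forget_ofRemovals_perm r.1).length_eq.trans r.2⟩
  have hf : Function.Injective f := fun r r' h =>
    Subtype.ext (forget_ofRemovals_injective (congrArg Subtype.val h))
  obtain ⟨r, hr⟩ := Finite.surjective_of_injective hf ⟨u, rfl⟩
  exact ⟨r.1, r.2, congrArg Subtype.val hr⟩

end Injectivity

/-- Every word u ∈ A admits exactly one successful partition; equivalently,
the forgetful map restricted to successful partitions is a bijection onto A. -/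
theorem exists_unique_successful_partition (m N : ℕ) [NeZero m] (u : List (Fin m))
    (hu : u.length = N) :
    ∃! P : Fin m → List (Fin m), forget P = u ∧ (invPresweep N P).isSome := by
  subst hu
  obtain ⟨r, hr, hru⟩ := exists_forget_ofRemovals_eq u
  refine ⟨ofRemovals r, ⟨hru, by simp [← hr, invPresweep_ofRemovals]⟩, ?_⟩
  rintro P ⟨hP, hsome⟩
  rw [invPresweep, Option.isSome_map, Option.isSome_iff_exists] at hsome
  obtain ⟨r', hr'⟩ := hsome
  obtain rfl := eq_ofRemovals_of_invPresweepAux (by rw [hP]) hr'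
  exact congrArg ofRemovals (forget_ofRemovals_injective (hP.trans hru.symm))
end

section
/- The sweep map sweep : A_Z → A_Z on words over an integer alphabet with fixed content is a bijection. -/
/-- Whether the step of size `u` arriving at `k` in the cycle `ZMod m` crosses the cut just
below `j`. -/
def cutCross {m : ℕ} (k u j : ZMod m) : ℕ :=
  if (k - j).val < u.val then 1 else 0

/-- The number of steps of size `u i` arriving at `b i` that cross the cut just below `j`. -/
def cutFlow {m N : ℕ} (u b : Fin N → ZMod m) (j : ZMod m) : ℕ :=
  ∑ i, cutCross (b i) (u i) j

lemma ZMod.val_sub_one_of_ne_zero {m : ℕ} [NeZero m] {d : ZMod m} (hd : d ≠ 0) :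
    (d - 1).val + 1 = d.val := by
  have h0 : d.val ≠ 0 := by simpa using hd
  have hlt := d.val_lt
  have : Fact (1 < m) := ⟨by omega⟩
  rw [ZMod.val_sub (by rw [ZMod.val_one]; omega), ZMod.val_one]
  omega

lemma ZMod.val_neg_one_add_one {m : ℕ} [NeZero m] : (-1 : ZMod m).val + 1 = m := by
  obtain ⟨n, rfl⟩ := Nat.exists_eq_succ_of_ne_zero (NeZero.ne m)
  rw [ZMod.val_neg_one]

lemma ZMod.val_sub_eq_ite {m : ℕ} [NeZero m] (k j : ZMod m) :
    (k - j).val = if j.val ≤ k.val then k.val - j.val else m + k.val - j.val := by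
  split_ifs with h
  · exact ZMod.val_sub h
  · push Not at h
    have h1 := ZMod.val_sub h.le
    have h2 : j - k ≠ 0 := fun h' => by
      rw [sub_eq_zero.1 h'] at h; exact lt_irrefl _ h
    have : NeZero (j - k) := ⟨h2⟩
    rw [← neg_sub j k, ZMod.val_neg_of_ne_zero, h1]
    omega

lemma sum_cutCross {m : ℕ} [NeZero m] (k u : ZMod m) : ∑ j, cutCross k u j = u.val := by
  have h : ∑ j, cutCross k u j = ∑ d : ZMod m, if d.val < u.val then 1 else 0 :=
    Fintype.sum_equiv (Equiv.subLeft k) _ _ fun j => rfl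
  rw [h, Finset.sum_boole, Nat.cast_id]
  have : (Finset.univ.filter fun d : ZMod m => d.val < u.val).image ZMod.val
      = Finset.range u.val := by
    ext x
    simp only [Finset.mem_image, Finset.mem_filter, Finset.mem_univ, true_and, Finset.mem_range]
    constructor
    · rintro ⟨d, hd, rfl⟩; exact hd
    · intro hx
      have hv := ZMod.val_cast_of_lt (hx.trans u.val_lt)
      exact ⟨x, by rwa [hv], hv⟩
  rw [← Finset.card_image_of_injective _ (ZMod.val_injective m), this, Finset.card_range]

lemma cutCross_sub_succ {m : ℕ} [NeZero m] (k u j : ZMod m) :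
    (cutCross k u j : ℤ) - cutCross k u (j + 1)
      = (if k = j then 1 else 0) - (if k - u = j then 1 else 0) := by
  have e1 : k - (j + 1) = (k - j) - 1 := by ring
  have e2 : (k = j) ↔ k - j = 0 := sub_eq_zero.symm
  have e3 : (k - u = j) ↔ (k - j).val = u.val := by
    rw [(ZMod.val_injective m).eq_iff]
    constructor <;> intro h <;> linear_combination h
  have hu := u.val_lt
  simp only [cutCross, e1, e2, e3]
  by_cases hd : k - j = 0
  · have := ZMod.val_neg_one_add_one (m := m)
    rw [hd, zero_sub, ZMod.val_zero, if_pos rfl]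
    push_cast
    split_ifs <;> omega
  · have := ZMod.val_sub_one_of_ne_zero hd
    rw [if_neg hd]
    push_cast
    split_ifs <;> omega

lemma cutCross_sub_one {m : ℕ} (k u j : ZMod m) :
    cutCross (k - 1) u j = cutCross k u (j + 1) := by
  unfold cutCross
  rw [show k - 1 - j = k - (j + 1) by ring]

lemma cutCross_le_of_val_le {m : ℕ} [NeZero m] {k k' : ZMod m} (u : ZMod m) {j : ZMod m}
    (h : k'.val ≤ k.val) (hj : j.val ≤ k.val → j.val ≤ k'.val) :
    cutCross k u j ≤ cutCross k' u j := by
  have := j.val_lt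
  unfold cutCross
  rw [ZMod.val_sub_eq_ite, ZMod.val_sub_eq_ite]
  split_ifs <;> omega

lemma sum_cutFlow {m N : ℕ} [NeZero m] (u b : Fin N → ZMod m) :
    ∑ j, cutFlow u b j = ∑ i, (u i).val := by
  simp only [cutFlow]
  rw [Finset.sum_comm]
  exact Finset.sum_congr rfl fun i _ => sum_cutCross _ _

lemma cutFlow_eq_of_le {m N : ℕ} [NeZero m] {u b b' : Fin N → ZMod m}
    (h : ∀ j, cutFlow u b j ≤ cutFlow u b' j) (j : ZMod m) : cutFlow u b j = cutFlow u b' j :=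
  (Finset.sum_eq_sum_iff_of_le fun j _ => h j).1
    ((sum_cutFlow u b).trans (sum_cutFlow u b').symm) j (Finset.mem_univ j)

lemma cutFlow_sub_succ {m N : ℕ} [NeZero m] (u b : Fin N → ZMod m) (j : ZMod m) :
    (cutFlow u b j : ℤ) - cutFlow u b (j + 1)
      = ∑ i, ((if b i = j then 1 else 0) - (if b i - u i = j then 1 else 0)) := by
  simp only [cutFlow, Nat.cast_sum, ← Finset.sum_sub_distrib, cutCross_sub_succ]

lemma Antitone.forall_imp_or_forall_imp {N : ℕ} {f g : Fin N → ℕ} (hf : Antitone f)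
    (hg : Antitone g) (p q : ℕ) :
    (∀ i, p ≤ f i → q ≤ g i) ∨ (∀ i, q ≤ g i → p ≤ f i) := by
  by_contra! h
  obtain ⟨⟨i, hi, hi'⟩, j, hj, hj'⟩ := h
  rcases le_total i j with hij | hij
  · have := hg hij; omega
  · have := hf hij; omega

lemma cutFlow_min {m N : ℕ} [NeZero m] {u b b' z : Fin N → ZMod m}
    (hb : Antitone fun i => (b i).val) (hb' : Antitone fun i => (b' i).val)
    (hF : ∀ j, cutFlow u b j = cutFlow u b' j)
    (hz : ∀ i, (z i).val = min (b i).val (b' i).val) (j : ZMod m) :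
    cutFlow u z j = cutFlow u b j := by
  refine (cutFlow_eq_of_le (fun j => ?_) j).symm
  rcases hb.forall_imp_or_forall_imp hb' j.val j.val with h | h
  · refine Finset.sum_le_sum fun i _ => cutCross_le_of_val_le _ ?_ ?_
    · rw [hz]; exact min_le_left _ _
    · intro hj; rw [hz]; exact le_min hj (h i hj)
  · rw [hF]
    refine Finset.sum_le_sum fun i _ => cutCross_le_of_val_le _ ?_ ?_
    · rw [hz]; exact min_le_right _ _
    · intro hj; rw [hz]; exact le_min (h i hj) hj

lemma cutFlow_max_sub_one {m N : ℕ} [NeZero m] {u b z c : Fin N → ZMod m}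
    (hb : Antitone fun i => (b i).val) (hz : Antitone fun i => (z i).val)
    (hF : ∀ j, cutFlow u z j = cutFlow u b j)
    (he : ∀ j ≠ 0, cutFlow u b (j + 1) ≤ cutFlow u b j)
    (hc : ∀ i, (c i).val = max (z i).val ((b i).val - 1)) (hzb : ∀ i, (z i).val ≤ (b i).val)
    (j : ZMod m) : cutFlow u c j = cutFlow u b j := by
  refine cutFlow_eq_of_le (fun j => ?_) j
  have key : (∀ i, j.val + 1 ≤ (b i).val → j.val ≤ (z i).val) →
      cutFlow u c j ≤ cutFlow u b j := fun h => by
    rw [← hF]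
    refine Finset.sum_le_sum fun i _ => cutCross_le_of_val_le _ ?_ fun hj => ?_
    · rw [hc]; exact le_max_left _ _
    · rw [hc] at hj
      have := h i
      omega
  by_cases hj0 : j = 0
  · exact key fun i _ => by simp [hj0]
  rcases hb.forall_imp_or_forall_imp hz (j.val + 1) j.val with h | h
  · exact key h
  refine le_trans (Finset.sum_le_sum fun i _ => ?_) (he j hj0)
  rw [← cutCross_sub_one]
  have hjv : j.val ≠ 0 := by simpa using hj0
  have hci := hc i
  have hzi := hzb i
  have hi := h i
  by_cases hbi : b i = 0
  · have := ZMod.val_neg_one_add_one (m := m)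
    have := j.val_lt
    rw [hbi, ZMod.val_zero] at hci hzi
    unfold cutCross
    rw [ZMod.val_sub_eq_ite, ZMod.val_sub_eq_ite, hbi, zero_sub]
    split_ifs <;> omega
  · have := ZMod.val_sub_one_of_ne_zero hbi
    refine cutCross_le_of_val_le _ ?_ fun hj => ?_ <;> omega

/-- If two block assignments have the same cut flows, the steps placed strictly lower by the
second one form a circulation with respect to the first one. -/
lemma circulation_of_cutFlow_eq {m N : ℕ} [NeZero m] {u b b' : Fin N → ZMod m}
    (hb : Antitone fun i => (b i).val) (hb' : Antitone fun i => (b' i).val)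
    (hF : ∀ j, cutFlow u b j = cutFlow u b' j)
    (he : ∀ j ≠ 0, cutFlow u b (j + 1) ≤ cutFlow u b j) (j : ZMod m) :
    (∑ i, if (b' i).val < (b i).val then (if b i = j then (1 : ℤ) else 0) else 0)
      = ∑ i, if (b' i).val < (b i).val then (if b i - u i = j then (1 : ℤ) else 0) else 0 := by
  let z : Fin N → ZMod m := fun i => if (b' i).val < (b i).val then b' i else b i
  let c : Fin N → ZMod m := fun i => if (b' i).val < (b i).val then b i - 1 else b i
  have hz : ∀ i, (z i).val = min (b i).val (b' i).val := fun i => by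
    simp only [z]; split_ifs <;> omega
  have hc : ∀ i, (c i).val = max (z i).val ((b i).val - 1) := fun i => by
    rw [hz]
    simp only [c]
    split_ifs with h
    · have := ZMod.val_sub_one_of_ne_zero (d := b i) (fun h0 => by simp [h0] at h)
      omega
    · omega
  have hzanti : Antitone fun i => (z i).val := fun i i' hi => by
    simp only [hz]; exact min_le_min (hb hi) (hb' hi)
  have hcF := cutFlow_max_sub_one hb hzanti (cutFlow_min hb hb' hF hz) he hc
    (fun i => by rw [hz]; exact min_le_left _ _) j
  rw [← sub_eq_zero, ← Finset.sum_sub_distrib]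
  have h0 : (cutFlow u b j : ℤ) - cutFlow u c j = 0 := by rw [hcF, sub_self]
  refine Eq.trans ?_ h0
  simp only [cutFlow, Nat.cast_sum, ← Finset.sum_sub_distrib]
  refine Finset.sum_congr rfl fun i _ => ?_
  simp only [c]
  by_cases h : (b' i).val < (b i).val
  · rw [if_pos h, if_pos h, if_pos h, cutCross_sub_one, cutCross_sub_succ]
  · rw [if_neg h, if_neg h, if_neg h, sub_self, sub_self]

/-- `u` arises from a walk `ℓ` on `ZMod m` by sorting the steps by the level they reach: `τ t` is
the place of step `t` in `u`, and `b i` is the level reached by the step at place `i`. -/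
structure IsSweepOf {m N : ℕ} (u b : Fin N → ZMod m) (τ : Fin N ≃ Fin N) (ℓ : ℕ → ZMod m) :
    Prop where
  zero : ℓ 0 = 0
  step : ∀ t : Fin N, ℓ (t + 1) = ℓ t + u (τ t)
  block : ∀ t : Fin N, b (τ t) = ℓ (t + 1)
  antitone : Antitone fun i => (b i).val
  order : ∀ s t, s < t → b (τ s) = b (τ t) → τ t < τ s

namespace IsSweepOf

variable {m N : ℕ} {u b b' : Fin N → ZMod m} {τ τ' : Fin N ≃ Fin N} {ℓ ℓ' : ℕ → ZMod m}

lemma last (h : IsSweepOf u b τ ℓ) : ℓ N = ∑ i, u i := by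
  have h1 := Finset.sum_range_sub ℓ N
  rw [h.zero, sub_zero] at h1
  rw [← h1, Finset.sum_range, ← τ.sum_comp u]
  exact Finset.sum_congr rfl fun t _ => by rw [h.step]; ring

lemma cutFlow_sub_succ [NeZero m] (h : IsSweepOf u b τ ℓ) (j : ZMod m) :
    (cutFlow u b j : ℤ) - cutFlow u b (j + 1)
      = (if ∑ i, u i = j then 1 else 0) - (if 0 = j then 1 else 0) := by
  have h1 := Finset.sum_range_sub (fun t => if ℓ t = j then (1 : ℤ) else 0) N
  rw [_root_.cutFlow_sub_succ, ← h.last, ← h.zero, ← h1, Finset.sum_range, ← τ.sum_comp]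
  refine Finset.sum_congr rfl fun t _ => ?_
  rw [h.block, show ℓ (t + 1) - u (τ t) = ℓ t by rw [h.step]; ring]

lemma cutFlow_eq [NeZero m] (h : IsSweepOf u b τ ℓ) (h' : IsSweepOf u b' τ' ℓ') (j : ZMod m) :
    cutFlow u b j = cutFlow u b' j := by
  have hs : ∀ j, (cutFlow u b (j + 1) : ℤ) - cutFlow u b' (j + 1)
      = cutFlow u b j - cutFlow u b' j := fun j => by
    linarith [h.cutFlow_sub_succ j, h'.cutFlow_sub_succ j]
  have hn : ∀ n : ℕ, (cutFlow u b n : ℤ) - cutFlow u b' n = cutFlow u b 0 - cutFlow u b' 0 := by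
    intro n
    induction n with
    | zero => simp
    | succ n ih => rw [Nat.cast_succ, hs, ih]
  have hall : ∀ j, (cutFlow u b j : ℤ) - cutFlow u b' j = cutFlow u b 0 - cutFlow u b' 0 :=
    fun j => by simpa using hn j.val
  rcases le_total (cutFlow u b 0) (cutFlow u b' 0) with h0 | h0
  · exact cutFlow_eq_of_le (fun j => by have := hall j; omega) j
  · exact (cutFlow_eq_of_le (fun j => by have := hall j; omega) j).symm

lemma val_le [NeZero m] (h : IsSweepOf u b τ ℓ) (h' : IsSweepOf u b' τ' ℓ') (i : Fin N) :
    (b i).val ≤ (b' i).val := by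
  have hcirc := circulation_of_cutFlow_eq h.antitone h'.antitone (h.cutFlow_eq h')
    (fun j hj => by
      have h1 := h.cutFlow_sub_succ j
      rw [if_neg hj.symm] at h1
      split_ifs at h1 <;> omega)
  have hex : ∀ i, (b' i).val < (b i).val → ∃ s, (b' s).val < (b s).val ∧ b s = b i - u i := by
    intro i hi
    by_contra! hno
    have h1 := hcirc (b i - u i)
    rw [Finset.sum_eq_zero fun s _ => by
      by_cases hs : (b' s).val < (b s).val
      · rw [if_pos hs, if_neg (hno s hs)]
      · rw [if_neg hs]] at h1
    have h2 := (Finset.sum_eq_zero_iff_of_nonneg fun s _ => by split_ifs <;> simp).1 h1.symm i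
      (Finset.mem_univ i)
    simp [hi] at h2
  have hno : ∀ n : ℕ, ∀ t : Fin N, (t : ℕ) = n → ¬ (b' (τ t)).val < (b (τ t)).val := by
    intro n
    induction n using Nat.strong_induction_on with
    | _ n ih =>
      rintro t rfl ht
      obtain ⟨s, hs, hst⟩ := hex _ ht
      obtain ⟨s, rfl⟩ := τ.surjective s
      rw [h.block t, show ℓ (t + 1) - u (τ t) = ℓ t by rw [h.step]; ring] at hst
      have hle : t ≤ s := by
        by_contra! hlt
        exact ih s hlt s rfl hs
      rcases Nat.eq_zero_or_eq_succ_pred (t : ℕ) with h0 | h0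
      · rw [h0, h.zero] at hst
        simp [hst] at hs
      · have hlt : (t : ℕ).pred < N := by omega
        let r : Fin N := ⟨(t : ℕ).pred, hlt⟩
        have hr : b (τ r) = b (τ s) := by
          rw [hst, h.block, h0]
        have hrs : r < s := by
          rw [Fin.lt_def]; simp only [r]; rw [Fin.le_def] at hle; omega
        have := h'.antitone (h.order r s hrs hr).le
        simp only at this
        refine ih r (by simp only [r]; omega) r rfl ?_
        rw [hr]; omega
  obtain ⟨t, rfl⟩ := τ.surjective i
  exact not_lt.1 (hno t t rfl)

lemma block_eq [NeZero m] (h : IsSweepOf u b τ ℓ) (h' : IsSweepOf u b' τ' ℓ') : b = b' :=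
  funext fun i => ZMod.val_injective m (le_antisymm (h.val_le h' i) (h'.val_le h i))

lemma perm_eq_of_block_eq (h : IsSweepOf u b τ ℓ) (h' : IsSweepOf u b τ' ℓ') : τ = τ' := by
  have main : ∀ n : ℕ, n ≤ N → ℓ n = ℓ' n ∧ ∀ s : Fin N, n ≤ s → τ s = τ' s := by
    intro n hn
    induction hn using Nat.decreasingInduction with
    | self => exact ⟨h.last.trans h'.last.symm, fun s hs => absurd s.2 (not_lt.2 hs)⟩
    | of_succ n hn ih =>
      obtain ⟨hl, hτ⟩ := ih
      let t : Fin N := ⟨n, hn⟩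
      have hbt : b (τ t) = b (τ' t) := by rw [h.block, h'.block]; exact hl
      have aux : ∀ {τ τ' : Fin N ≃ Fin N} {ℓ' : ℕ → ZMod m}, IsSweepOf u b τ' ℓ' →
          (∀ s : Fin N, n + 1 ≤ s → τ s = τ' s) → b (τ t) = b (τ' t) → τ' t ≤ τ t := by
        intro τ τ' ℓ' h' hτ hbt
        obtain ⟨s, hs⟩ := τ'.surjective (τ t)
        rw [← hs]
        rcases lt_trichotomy s t with hst | rfl | hst
        · exact (h'.order s t hst (by rw [hs, hbt])).le
        · rfl
        · have : s = t := τ.injective ((hτ s hst).trans hs)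
          rw [this]
      have ht : τ t = τ' t :=
        le_antisymm (aux h (fun s hs => (hτ s hs).symm) hbt.symm) (aux h' hτ hbt)
      refine ⟨?_, fun s hs => ?_⟩
      · have h1 := h.step t
        have h2 := h'.step t
        rw [← ht] at h2
        simp only [t] at h1 h2
        rw [hl, h2] at h1
        exact (add_right_cancel h1).symm
      · rcases hs.eq_or_lt with hs | hs
        · rwa [show s = t from Fin.ext hs.symm]
        · exact hτ s hs
  exact Equiv.ext fun s => (main 0 (Nat.zero_le _)).2 s (Nat.zero_le _)

lemma perm_eq [NeZero m] (h : IsSweepOf u b τ ℓ) (h' : IsSweepOf u b' τ' ℓ') : τ = τ' := by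
  obtain rfl := h.block_eq h'
  exact h.perm_eq_of_block_eq h'

end IsSweepOf

/-- The positions of the letters of `w`, in the order in which the sweep map reads them. -/
def sweepPositions (w : List ℤ) : List ℕ :=
  (sweepKeys w).flatMap fun k => (List.range w.length).reverse.filter fun j => zlevel w j = k

lemma zsweep_eq_map_sweepPositions (w : List ℤ) :
    zsweep w = (sweepPositions w).map fun j => w.getD j 0 := by
  rw [zsweep, sweepPositions, List.map_flatMap]
  congr 1
  funext k
  induction (List.range w.length).reverse with
  | nil => rfl
  | cons x l ih =>
    by_cases h : zlevel w x = k <;> simpa [h] using ih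

lemma abs_sum_le_sum_natAbs (w : List ℤ) : |w.sum| ≤ (w.map Int.natAbs).sum := by
  induction w with
  | nil => simp
  | cons x l ih =>
    simp only [List.sum_cons, List.map_cons, Nat.cast_add, Int.natCast_natAbs]
    exact (abs_add_le _ _).trans (by gcongr)

lemma abs_zlevel_le (w : List ℤ) (j : ℕ) : |zlevel w j| ≤ (w.map Int.natAbs).sum := by
  refine (abs_sum_le_sum_natAbs _).trans (Nat.cast_le.2 ?_)
  rw [List.map_take]
  exact ((List.take_sublist _ _).sum_le_sum fun _ _ => Nat.zero_le _)

lemma sweepKeys_eq (w : List ℤ) :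
    sweepKeys w
      = (List.range (w.map Int.natAbs).sum).map (fun t : ℕ => -((t : ℤ) + 1)) ++
        (List.range ((w.map Int.natAbs).sum + 1)).reverse.map fun t : ℕ => (t : ℤ) := by
  simp only [sweepKeys, List.pure_def, List.bind_eq_flatMap, ← List.map_eq_flatMap, List.map_map]
  rfl

lemma mem_sweepKeys (w : List ℤ) (k : ℤ) (hk : |k| ≤ (w.map Int.natAbs).sum) :
    k ∈ sweepKeys w := by
  rw [abs_le] at hk
  simp only [sweepKeys_eq, List.mem_append, List.mem_map, List.mem_reverse, List.mem_range]
  rcases lt_or_ge k 0 with h | h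
  · exact Or.inl ⟨(-k - 1).toNat, by omega, by omega⟩
  · exact Or.inr ⟨k.toNat, by omega, by omega⟩

lemma mem_sweepPositions (w : List ℤ) (j : ℕ) : j ∈ sweepPositions w ↔ j < w.length := by
  simp only [sweepPositions, List.mem_flatMap, List.mem_filter, List.mem_reverse, List.mem_range,
    decide_eq_true_eq]
  exact ⟨fun ⟨_, _, h, _⟩ => h, fun h => ⟨_, mem_sweepKeys w _ (abs_zlevel_le w j), h, rfl⟩⟩

lemma pairwise_sweepKeys (w : List ℤ) :
    (sweepKeys w).Pairwise fun k k' : ℤ =>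
      (k' : ZMod (2 * (w.map Int.natAbs).sum + 1)).val
        < (k : ZMod (2 * (w.map Int.natAbs).sum + 1)).val := by
  have hval : ∀ k : ℤ, ((k : ZMod (2 * (w.map Int.natAbs).sum + 1)).val : ℤ)
      = k % (2 * (w.map Int.natAbs).sum + 1 : ℕ) := fun k => ZMod.val_intCast k
  simp only [← Int.ofNat_lt, hval]
  rw [sweepKeys_eq, List.pairwise_append, List.pairwise_map, List.pairwise_map,
    List.pairwise_reverse]
  generalize (w.map Int.natAbs).sum = M
  have hneg : ∀ t : ℕ, t < M → -((t : ℤ) + 1) % (2 * M + 1 : ℕ) = 2 * M - t := fun t ht => by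
    rw [← Int.add_emod_right, Int.emod_eq_of_lt] <;> push_cast <;> omega
  have hpos : ∀ t : ℕ, t < M + 1 → (t : ℤ) % (2 * M + 1 : ℕ) = t := fun t ht =>
    Int.emod_eq_of_lt (by omega) (by push_cast; omega)
  refine ⟨List.pairwise_lt_range.imp_of_mem fun hs ht h => ?_,
    List.pairwise_lt_range.imp_of_mem fun hs ht h => ?_, fun k hk k' hk' => ?_⟩
  · rw [List.mem_range] at hs ht
    rw [hneg _ hs, hneg _ ht]; omega
  · rw [List.mem_range] at hs ht
    rw [hpos _ hs, hpos _ ht]; omega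
  · simp only [List.mem_map, List.mem_reverse, List.mem_range] at hk hk'
    obtain ⟨s, hs, rfl⟩ := hk
    obtain ⟨t, ht, rfl⟩ := hk'
    rw [hneg _ hs, hpos _ ht]; omega

lemma pairwise_sweepPositions (w : List ℤ) :
    (sweepPositions w).Pairwise fun s t =>
      (zlevel w t : ZMod (2 * (w.map Int.natAbs).sum + 1)).val
          < (zlevel w s : ZMod (2 * (w.map Int.natAbs).sum + 1)).val ∨
        zlevel w s = zlevel w t ∧ t < s := by
  rw [sweepPositions, List.pairwise_flatMap]
  constructor
  · intro k _
    have h : (List.range w.length).reverse.Pairwise fun s t => t < s :=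
      List.pairwise_reverse.2 List.pairwise_lt_range
    refine (h.filter _).imp_of_mem fun hs ht hst => Or.inr ⟨?_, hst⟩
    simp only [List.mem_filter, decide_eq_true_eq] at hs ht
    rw [hs.2, ht.2]
  · refine (pairwise_sweepKeys w).imp fun hk s hs t ht => Or.inl ?_
    simp only [List.mem_filter, decide_eq_true_eq] at hs ht
    rwa [hs.2, ht.2]

lemma sweepPositions_perm_range (w : List ℤ) : (sweepPositions w).Perm (List.range w.length) := by
  refine (List.perm_ext_iff_of_nodup ?_ List.nodup_range).2 fun j => by
    rw [mem_sweepPositions, List.mem_range]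
  refine (pairwise_sweepPositions w).imp fun h => ?_
  rintro rfl
  rcases h with h | h <;> exact absurd h (by simp)

lemma zsweep_perm (w : List ℤ) : (zsweep w).Perm w := by
  rw [zsweep_eq_map_sweepPositions]
  refine ((sweepPositions_perm_range w).map _).trans (List.Perm.of_eq ?_)
  refine List.ext_getElem (by simp) fun i h _ => ?_
  simp at h
  simp [h]

lemma exists_isSweepOf {w U : List ℤ} {N M : ℕ} (hU : zsweep w = U) (hN : w.length = N)
    (hM : (w.map Int.natAbs).sum = M) :
    ∃ (b : Fin N → ZMod (2 * M + 1)) (τ : Fin N ≃ Fin N),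
      IsSweepOf (fun i => (U.getD i 0 : ZMod (2 * M + 1))) b τ (fun t => ((w.take t).sum : ℤ)) ∧
        ∀ t : Fin N, w.getD t 0 = U.getD (τ t) 0 := by
  subst hU hN hM
  have hlen : (sweepPositions w).length = w.length := by
    simpa using (sweepPositions_perm_range w).length_eq
  have hpw := List.pairwise_iff_getElem.1 (pairwise_sweepPositions w)
  let f : Fin w.length → Fin w.length := fun i =>
    ⟨(sweepPositions w)[i]'(by rw [hlen]; exact i.2),
      (mem_sweepPositions w _).1 (List.getElem_mem _)⟩
  have hf : ∀ i i' : Fin w.length, i < i' →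
      (zlevel w (f i') : ZMod (2 * (w.map Int.natAbs).sum + 1)).val
          < (zlevel w (f i) : ZMod (2 * (w.map Int.natAbs).sum + 1)).val ∨
        zlevel w (f i) = zlevel w (f i') ∧ f i' < f i := fun i i' hi =>
    hpw i i' (by rw [hlen]; exact i.2) (by rw [hlen]; exact i'.2) hi
  have hinj : Function.Injective f := by
    have hne : ∀ i i', i < i' → f i ≠ f i' := fun i i' hi he => by
      have := hf i i' hi
      simp [he] at this
    intro i i' he
    rcases lt_trichotomy i i' with hi | hi | hi
    · exact absurd he (hne i i' hi)
    · exact hi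
    · exact absurd he.symm (hne i' i hi)
  let τ : Fin w.length ≃ Fin w.length :=
    (Equiv.ofBijective f (Finite.injective_iff_bijective.1 hinj)).symm
  have hfτ : ∀ t, f (τ t) = t := (Equiv.ofBijective f _).apply_symm_apply
  have hlet : ∀ t : Fin w.length, w.getD t 0 = (zsweep w).getD (τ t) 0 := fun t => by
    have h1 : (zsweep w).getD (τ t) 0 = w.getD (f (τ t)) 0 := by
      simp [zsweep_eq_map_sweepPositions, f, hlen]
    rw [h1, hfτ]
  refine ⟨fun i => (zlevel w (f i) : ℤ), τ, ⟨by simp, fun t => ?_, fun t => ?_, ?_, ?_⟩, hlet⟩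
  · rw [← hlet t, ← Int.cast_add, List.sum_take_succ _ _ t.2]
    simp
  · rw [hfτ]; rfl
  · intro i i' hi
    rcases hi.eq_or_lt with rfl | hi
    · rfl
    · rcases hf i i' hi with h | h
      · exact h.le
      · simp only [h.1, le_refl]
  · intro s t hst hb
    by_contra! hle
    rcases hle.eq_or_lt with he | hlt
    · exact hst.ne (τ.injective he)
    · have := hf _ _ hlt
      simp only [hfτ] at hb this
      simp only [hb, lt_irrefl, false_or] at this
      exact lt_asymm hst this.2

lemma zsweep_injective : Function.Injective zsweep := by
  intro w w' h
  have hp : w.Perm w' := ((zsweep_perm w).symm.trans (List.Perm.of_eq h)).trans (zsweep_perm w')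
  obtain ⟨b, τ, hτ, hl⟩ := exists_isSweepOf h hp.length_eq (hp.map Int.natAbs).sum_eq
  obtain ⟨b', τ', hτ', hl'⟩ := exists_isSweepOf (w := w') rfl rfl rfl
  obtain rfl := hτ.perm_eq hτ'
  refine List.ext_getElem hp.length_eq fun i h1 h2 => ?_
  have := (hl ⟨i, h2⟩).trans (hl' ⟨i, h2⟩).symm
  simpa [h1, h2] using this

/-- The sweep map on words over the integer alphabet with fixed content
(e_j copies of a_j) is a bijection A_ℤ → A_ℤ. -/
theorem sweep_bijective (n : ℕ) (a : Fin n → ℤ) (e : Fin n → ℕ) :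
    Set.BijOn zsweep (AZ n a e) (AZ n a e) := by
  have hfin : (AZ n a e).Finite := by
    refine ((∑ j : Fin n, Multiset.replicate (e j) (a j)).toList.permutations.finite_toSet).subset
      fun w hw => ?_
    rw [Set.mem_ofPred_eq, List.mem_permutations, ← Multiset.coe_eq_coe, Multiset.coe_toList]
    exact hw
  refine (hfin.injOn_iff_bijOn_of_mapsTo fun w hw => ?_).1 fun w _ w' _ h => zsweep_injective h
  exact (Multiset.coe_eq_coe.2 (zsweep_perm w)).trans hw
end
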